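/- arXiv:2207.03268 — 6 statements merged into one kernel-verified Lean document; each statement's English description precedes it below -/
import Mathlib

section
/- For every real matrix A ∈ ℝ^{m×n}, letting λ_1 ≥ λ_2 ≥ ⋯ ≥ λ_n ≥ 0 denote the eigenvalues of the positive semidefinite matrix AᵀA, for every positive integer k ≤ min{n, m} one has herdisc(A) ≥ (k/(2e))·√(λ_k/(m·n)). -/
open Matrix

/-- The discrepancy of a real matrix: the minimum over colorings `x ∈ {-1,1}` of the
columns of the maximum absolute value of the entries of `A x`. -/
noncomputable def disc {I J : Type*} [Fintype I] [Fintype J] (A : Matrix I J ℝ) : ℝ :=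
  sInf {d : ℝ | ∃ x : J → ℝ, (∀ j, x j = 1 ∨ x j = -1) ∧ d = ⨆ i, |A.mulVec x i|}

/-- The hereditary discrepancy: the maximum discrepancy over all submatrices obtained by
deleting a subset of the columns. -/
noncomputable def herdisc {m n : ℕ} (A : Matrix (Fin m) (Fin n) ℝ) : ℝ :=
  sSup {d : ℝ | ∃ S : Finset (Fin n),
    d = disc (A.submatrix id (fun j : {j // j ∈ S} => (j : Fin n)))}

/-- The Cauchy–Binet formula, summed over all maps `K → J` instead of over subsets of `J`. -/
theorem Matrix.factorial_mul_det_mul {R J K : Type*} [CommRing R] [Fintype J] [Fintype K]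
    [DecidableEq K] (M : Matrix K J R) (N : Matrix J K R) :
    ((Fintype.card K).factorial : R) * (M * N).det =
      ∑ f : K → J, (M.submatrix id f).det * (N.submatrix f id).det := by
  classical
  have expand : (M * N).det = ∑ f : K → J, (∏ i, M i (f i)) * (N.submatrix f id).det := by
    have hrow : (M * N) = fun i => ∑ j, M i j • N j := by
      ext i l
      simp [Matrix.mul_apply, Finset.sum_apply]
    rw [hrow]
    change (Matrix.detRowAlternating (R := R) (n := K)).toMultilinearMap _ = _
    rw [MultilinearMap.map_sum]
    refine Finset.sum_congr rfl fun f _ => ?_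
    rw [MultilinearMap.map_smul_univ]
    rfl
  have perm (σ : Equiv.Perm K) :
      ∑ f : K → J, ((Equiv.Perm.sign σ : ℤ) : R) * (∏ i, M (σ i) (f i)) * (N.submatrix f id).det
        = (M * N).det := by
    rw [expand]
    refine Fintype.sum_equiv (σ.arrowCongr (Equiv.refl J)) _ _ fun f => ?_
    have h1 : ∏ i, M i ((σ.arrowCongr (Equiv.refl J)) f i) = ∏ i, M (σ i) (f i) :=
      (Fintype.prod_equiv σ _ _ (by simp)).symm
    have h2 : N.submatrix ((σ.arrowCongr (Equiv.refl J)) f) id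
        = (N.submatrix f id).submatrix (σ⁻¹ : Equiv.Perm K) id := by
      ext i l
      simp [Equiv.Perm.inv_def]
    rw [h1, h2, Matrix.det_permute, Equiv.Perm.sign_inv]
    ring
  calc ((Fintype.card K).factorial : R) * (M * N).det
      = ∑ _σ : Equiv.Perm K, (M * N).det := by
        simp [Fintype.card_perm]
    _ = ∑ σ : Equiv.Perm K, ∑ f : K → J,
          ((Equiv.Perm.sign σ : ℤ) : R) * (∏ i, M (σ i) (f i)) * (N.submatrix f id).det :=
        Finset.sum_congr rfl fun σ _ => (perm σ).symm
    _ = ∑ f : K → J, (M.submatrix id f).det * (N.submatrix f id).det := by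
        rw [Finset.sum_comm]
        refine Finset.sum_congr rfl fun f _ => ?_
        rw [Matrix.det_apply' (M.submatrix id f), Finset.sum_mul]
        rfl

/-- The Gram determinant as a sum of squared minors. -/
theorem Matrix.factorial_mul_det_transpose_mul_self {R J K : Type*} [CommRing R] [Fintype J]
    [Fintype K] [DecidableEq K] (P : Matrix J K R) :
    ((Fintype.card K).factorial : R) * (Pᵀ * P).det =
      ∑ f : K → J, (P.submatrix f id).det ^ 2 := by
  rw [Matrix.factorial_mul_det_mul]
  refine Finset.sum_congr rfl fun f _ => ?_
  rw [← Matrix.transpose_submatrix, Matrix.det_transpose, sq]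

/-- The Gram determinant of `A * V`, with `V` having orthonormal columns, is bounded by the sum of
the squared minors of `A`. -/
theorem Matrix.factorial_sq_mul_det_le_sum_sq_det {I J K : Type*} [Fintype I] [Fintype J]
    [Fintype K] [DecidableEq K] (A : Matrix I J ℝ) (V : Matrix J K ℝ) (hV : Vᵀ * V = 1) :
    ((Fintype.card K).factorial : ℝ) ^ 2 * ((A * V)ᵀ * (A * V)).det ≤
      ∑ f : K → I, ∑ g : K → J, (A.submatrix f g).det ^ 2 := by
  set c : ℝ := ((Fintype.card K).factorial : ℝ) with hc
  have hc0 : 0 < c := by positivity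
  have minor (M : Matrix K J ℝ) : c * (M * V).det ^ 2 ≤
      ∑ g : K → J, (M.submatrix id g).det ^ 2 := by
    have h := Finset.sum_mul_sq_le_sq_mul_sq Finset.univ
      (fun g : K → J => (M.submatrix id g).det) (fun g => (V.submatrix g id).det)
    rw [← Matrix.factorial_mul_det_mul, ← Matrix.factorial_mul_det_transpose_mul_self V, hV,
      Matrix.det_one, ← hc] at h
    have : c * (c * (M * V).det ^ 2) ≤ c * ∑ g : K → J, (M.submatrix id g).det ^ 2 := by
      linarith
    exact le_of_mul_le_mul_left this hc0
  calc c ^ 2 * ((A * V)ᵀ * (A * V)).det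
      = c * ∑ f : K → I, ((A * V).submatrix f id).det ^ 2 := by
        rw [← Matrix.factorial_mul_det_transpose_mul_self]
        ring
    _ = ∑ f : K → I, c * (A.submatrix f id * V).det ^ 2 := by
        rw [Finset.mul_sum]
        rfl
    _ ≤ _ := Finset.sum_le_sum fun f _ => minor (A.submatrix f id)

/-- Iterated rounding: if every set of columns of `B` has a signing of discrepancy at most `h`,
then every dyadic vector can be rounded to an integer vector with error at most `h`. -/
theorem Matrix.exists_int_round_dyadic {I K : Type*} [Fintype K] (B : Matrix I K ℝ) (h : ℝ)
    (hB : ∀ S : Set K, ∃ x : K → ℤ, (∀ j ∈ S, x j = 1 ∨ x j = -1) ∧ (∀ j ∉ S, x j = 0) ∧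
      ∀ i, |B.mulVec (fun j => (x j : ℝ)) i| ≤ h) (t : ℕ) (u : K → ℤ) :
    ∃ z : K → ℤ, (∀ j, |(z j : ℝ) - u j / 2 ^ t| ≤ 1 - 1 / 2 ^ t) ∧
      ∀ i, |B.mulVec (fun j => (z j : ℝ) - u j / 2 ^ t) i| ≤ h * (1 - 1 / 2 ^ t) := by
  induction t generalizing u with
  | zero =>
    refine ⟨u, by simp, fun i => ?_⟩
    have : (fun j => (u j : ℝ) - u j / 2 ^ 0) = 0 := by ext; simp
    rw [this]
    simp
  | succ t ih =>
    obtain ⟨x, hx1, hx0, hx⟩ := hB {j | Odd (u j)}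
    have hdvd (j : K) : ∃ v, u j + x j = 2 * v := by
      by_cases hj : Odd (u j)
      · obtain ⟨a, ha⟩ := hj
        rcases hx1 j ⟨a, ha⟩ with h1 | h1
        · exact ⟨a + 1, by lia⟩
        · exact ⟨a, by lia⟩
      · rw [hx0 j hj]
        obtain ⟨a, ha⟩ := Int.not_odd_iff_even.mp hj
        exact ⟨a, by lia⟩
    have habs (j : K) : |(x j : ℝ)| ≤ 1 := by
      by_cases hj : Odd (u j)
      · rcases hx1 j hj with h1 | h1 <;> simp [h1]
      · simp [hx0 j hj]
    choose v hv using hdvd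
    obtain ⟨z, hz1, hz2⟩ := ih v
    have hpos : (0 : ℝ) < 2 ^ t := by positivity
    have key (j : K) : (z j : ℝ) - u j / 2 ^ (t + 1)
        = ((z j : ℝ) - v j / 2 ^ t) + (1 / 2 ^ (t + 1)) * x j := by
      have : (u j : ℝ) = 2 * v j - x j := by
        have := hv j
        have h' : (u j : ℝ) + x j = 2 * v j := by exact_mod_cast this
        linarith
      rw [this]
      field_simp
      ring
    have hsum : (1 : ℝ) - 1 / 2 ^ (t + 1) = (1 - 1 / 2 ^ t) + 1 / 2 ^ (t + 1) := by
      field_simp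
      ring
    have hp : (0 : ℝ) ≤ 1 / 2 ^ (t + 1) := by positivity
    refine ⟨z, fun j => ?_, fun i => ?_⟩
    · rw [key, hsum]
      refine (abs_add_le _ _).trans (add_le_add (hz1 j) ?_)
      rw [abs_mul, abs_of_nonneg hp]
      exact mul_le_of_le_one_right hp (habs j)
    · have : (fun j => (z j : ℝ) - u j / 2 ^ (t + 1))
          = (fun j => (z j : ℝ) - v j / 2 ^ t) + (1 / 2 ^ (t + 1) : ℝ) • fun j => (x j : ℝ) := by
        ext j
        simp only [key, Pi.add_apply, Pi.smul_apply, smul_eq_mul]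
      rw [this, Matrix.mulVec_add, Matrix.mulVec_smul, hsum, mul_add]
      refine (abs_add_le _ _).trans (add_le_add (hz2 i) ?_)
      rw [Pi.smul_apply, smul_eq_mul, abs_mul, abs_of_nonneg hp, mul_comm]
      exact mul_le_mul_of_nonneg_right (hx i) hp

/-- Under the hypothesis of `Matrix.exists_int_round_dyadic`, real vectors can be rounded to
integer vectors with error arbitrarily close to `h`. -/
theorem Matrix.exists_int_round {I K : Type*} [Fintype I] [Fintype K] (B : Matrix I K ℝ) (h : ℝ)
    (h0 : 0 ≤ h)
    (hB : ∀ S : Set K, ∃ x : K → ℤ, (∀ j ∈ S, x j = 1 ∨ x j = -1) ∧ (∀ j ∉ S, x j = 0) ∧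
      ∀ i, |B.mulVec (fun j => (x j : ℝ)) i| ≤ h) {ε : ℝ} (hε : 0 < ε) (w : K → ℝ) :
    ∃ z : K → ℤ, (∀ j, |(z j : ℝ) - w j| ≤ 1) ∧
      ∀ i, |B.mulVec (fun j => (z j : ℝ) - w j) i| ≤ h + ε := by
  set C : ℝ := ∑ i, ∑ j, |B i j| with hC
  have hC0 : 0 ≤ C := by positivity
  obtain ⟨t, ht⟩ := exists_pow_lt_of_lt_one (show 0 < ε / (C + 1) by positivity)
    (show (2⁻¹ : ℝ) < 1 by norm_num)
  have hpos : (0 : ℝ) < 2 ^ t := by positivity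
  rw [inv_pow, ← one_div] at ht
  obtain ⟨z, hz1, hz2⟩ := B.exists_int_round_dyadic h hB t (fun j => ⌊2 ^ t * w j⌋)
  have hround (j : K) : |((⌊2 ^ t * w j⌋ : ℤ) : ℝ) / 2 ^ t - w j| ≤ 1 / 2 ^ t := by
    have e : ((⌊2 ^ t * w j⌋ : ℤ) : ℝ) / 2 ^ t - w j
        = -(Int.fract (2 ^ t * w j) / 2 ^ t) := by
      rw [← Int.self_sub_floor]
      field_simp
      ring
    rw [e, abs_neg, abs_of_nonneg (div_nonneg (Int.fract_nonneg _) hpos.le)]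
    gcongr
    exact (Int.fract_lt_one _).le
  refine ⟨z, fun j => ?_, fun i => ?_⟩
  · have := abs_sub_le (z j : ℝ) (((⌊2 ^ t * w j⌋ : ℤ) : ℝ) / 2 ^ t) (w j)
    linarith [hz1 j, hround j]
  · have e : (fun j => (z j : ℝ) - w j)
        = (fun j => (z j : ℝ) - ((⌊2 ^ t * w j⌋ : ℤ) : ℝ) / 2 ^ t)
          + fun j => ((⌊2 ^ t * w j⌋ : ℤ) : ℝ) / 2 ^ t - w j := by
      ext j
      simp
    rw [e, Matrix.mulVec_add]
    refine (abs_add_le _ _).trans (add_le_add ((hz2 i).trans ?_) ?_)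
    · exact mul_le_of_le_one_right h0 (by simp)
    · calc |B.mulVec (fun j => ((⌊2 ^ t * w j⌋ : ℤ) : ℝ) / 2 ^ t - w j) i|
          ≤ ∑ j, |B i j * (((⌊2 ^ t * w j⌋ : ℤ) : ℝ) / 2 ^ t - w j)| :=
            Finset.abs_sum_le_sum_abs _ _
        _ ≤ ∑ j, |B i j| * (1 / 2 ^ t) := by
            refine Finset.sum_le_sum fun j _ => ?_
            rw [abs_mul]
            exact mul_le_mul_of_nonneg_left (hround j) (abs_nonneg _)
        _ ≤ C * (1 / 2 ^ t) := by
            rw [← Finset.sum_mul]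
            refine mul_le_mul_of_nonneg_right ?_ (by positivity)
            exact Finset.single_le_sum (f := fun i => ∑ j, |B i j|)
              (fun _ _ => by positivity) (Finset.mem_univ i)
        _ ≤ (C + 1) * (ε / (C + 1)) := by
            refine mul_le_mul (by linarith) ht.le (by positivity) (by positivity)
        _ = ε := by field_simp

open MeasureTheory in
/-- If the parallelepiped `{y | ‖B y‖_∞ ≤ r}` covers space under integer translations of bounded
size, then its volume is at least one. -/
theorem Matrix.abs_det_le_of_exists_int_round {K : Type*} [Fintype K] [DecidableEq K]
    (B : Matrix K K ℝ) {r : ℝ} (hr : 0 ≤ r)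
    (hround : ∀ w : K → ℝ, ∃ z : K → ℤ, (∀ j, |(z j : ℝ) - w j| ≤ 1) ∧
      ∀ i, |B.mulVec (fun j => (z j : ℝ) - w j) i| ≤ r) :
    |B.det| ≤ (2 * r) ^ Fintype.card K := by
  set d := Fintype.card K with hd
  by_cases hdet : B.det = 0
  · rw [hdet, abs_zero]
    positivity
  set P : Set (K → ℝ) := Matrix.toLin' B ⁻¹' Set.Icc (fun _ => -r) (fun _ => r) with hP
  have hvol : volume P = ENNReal.ofReal (|B.det|⁻¹ * (2 * r) ^ d) := by
    rw [hP, Measure.addHaar_preimage_linearMap _ (by rwa [LinearMap.det_toLin']),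
      LinearMap.det_toLin', Real.volume_Icc_pi, ENNReal.ofReal_mul (by positivity), abs_inv]
    simp only [sub_neg_eq_add, Finset.prod_const, Finset.card_univ, ← hd]
    rw [← ENNReal.ofReal_pow (by positivity), two_mul]
  have hbound (N : ℕ) : |B.det| * (N : ℝ) ^ d ≤ ((N : ℝ) + 3) ^ d * (2 * r) ^ d := by
    set Z : Finset (K → ℤ) := Fintype.piFinset fun _ => Finset.Icc (-1 : ℤ) (N + 1) with hZ
    have hcard : Z.card = (N + 3) ^ d := by
      rw [hZ, Fintype.card_piFinset, Finset.prod_const, Finset.card_univ, Int.card_Icc, ← hd]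
      congr 1
    have hcover : Set.Icc (fun _ : K => (0 : ℝ)) (fun _ => (N : ℝ)) ⊆
        ⋃ z ∈ Z, (fun w : K → ℝ => (fun j => -(z j : ℝ)) + w) ⁻¹' P := by
      intro w hw
      obtain ⟨z, hz1, hz2⟩ := hround w
      refine Set.mem_biUnion (x := z) ?_ ?_
      · rw [Finset.mem_coe, hZ, Fintype.mem_piFinset]
        intro j
        have h1 := abs_le.mp (hz1 j)
        have h2 := hw.1 j
        have h3 := hw.2 j
        simp only at h2 h3
        rw [Finset.mem_Icc]
        constructor
        · have : (-1 : ℝ) ≤ z j := by linarith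
          exact_mod_cast this
        · have : (z j : ℝ) ≤ N + 1 := by linarith
          exact_mod_cast this
      · have e : (fun j => -(z j : ℝ)) + w = -(fun j => (z j : ℝ) - w j) := by
          ext j
          simp
          ring
        rw [Set.mem_preimage, e, hP, Set.mem_preimage, Matrix.toLin'_apply, Matrix.mulVec_neg]
        exact ⟨fun i => by have := abs_le.mp (hz2 i); simp only [Pi.neg_apply]; linarith,
          fun i => by have := abs_le.mp (hz2 i); simp only [Pi.neg_apply]; linarith⟩
    have hle := (measure_mono hcover (μ := volume)).trans (measure_biUnion_finset_le _ _)
    simp only [measure_preimage_add, hvol, Finset.sum_const, hcard, Real.volume_Icc_pi, sub_zero,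
      Finset.prod_const, Finset.card_univ, ← hd, nsmul_eq_mul] at hle
    rw [← ENNReal.ofReal_pow (by positivity), ← ENNReal.ofReal_natCast,
      ← ENNReal.ofReal_mul (by positivity), ENNReal.ofReal_le_ofReal_iff (by positivity)] at hle
    push_cast at hle
    have hpos : 0 < |B.det| := abs_pos.mpr hdet
    calc |B.det| * (N : ℝ) ^ d
        ≤ |B.det| * (((N : ℝ) + 3) ^ d * (|B.det|⁻¹ * (2 * r) ^ d)) := by gcongr
      _ = _ := by field_simp
  have hlim : Filter.Tendsto (fun N : ℕ => (1 + 3 / (N : ℝ)) ^ d * (2 * r) ^ d) Filter.atTop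
      (nhds ((1 + 0) ^ d * (2 * r) ^ d)) :=
    (((tendsto_const_div_atTop_nhds_zero_nat 3).const_add 1).pow d).mul_const _
  rw [add_zero, one_pow, one_mul] at hlim
  refine ge_of_tendsto hlim ?_
  filter_upwards [Filter.eventually_gt_atTop 0] with N hN
  have hN' : (0 : ℝ) < N := by exact_mod_cast hN
  have e : 1 + 3 / (N : ℝ) = (N + 3) / N := by field_simp
  rw [e, div_pow, div_mul_eq_mul_div, le_div_iff₀ (by positivity)]
  exact hbound N

/-- The determinant lower bound for hereditary discrepancy, for a square matrix. -/
theorem Matrix.abs_det_le_of_forall_exists_signing {K : Type*} [Fintype K] [DecidableEq K]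
    (B : Matrix K K ℝ) {h : ℝ} (h0 : 0 ≤ h)
    (hB : ∀ S : Set K, ∃ x : K → ℤ, (∀ j ∈ S, x j = 1 ∨ x j = -1) ∧ (∀ j ∉ S, x j = 0) ∧
      ∀ i, |B.mulVec (fun j => (x j : ℝ)) i| ≤ h) :
    |B.det| ≤ (2 * h) ^ Fintype.card K := by
  have hlim : Filter.Tendsto (fun ε : ℝ => (2 * (h + ε)) ^ Fintype.card K)
      (nhdsWithin 0 (Set.Ioi 0)) (nhds ((2 * (h + 0)) ^ Fintype.card K)) :=
    (Continuous.tendsto (by fun_prop) 0).mono_left nhdsWithin_le_nhds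
  rw [add_zero] at hlim
  refine ge_of_tendsto hlim ?_
  filter_upwards [self_mem_nhdsWithin] with ε hε
  have hε' : 0 < ε := hε
  exact B.abs_det_le_of_exists_int_round (by positivity) (B.exists_int_round h h0 hB hε')

theorem finite_setOf_signing_discrepancy {I J : Type*} [Fintype I] [Fintype J]
    (A : Matrix I J ℝ) :
    {d : ℝ | ∃ x : J → ℝ, (∀ j, x j = 1 ∨ x j = -1) ∧ d = ⨆ i, |A.mulVec x i|}.Finite := by
  have hfin : (Set.univ.pi fun _ : J => ({1, -1} : Set ℝ)).Finite :=
    Set.Finite.pi fun _ => Set.toFinite _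
  refine (hfin.image fun x => ⨆ i, |A.mulVec x i|).subset ?_
  rintro d ⟨x, hx, rfl⟩
  exact ⟨x, fun j _ => hx j, rfl⟩

theorem exists_signing_eq_disc {I J : Type*} [Fintype I] [Fintype J] (A : Matrix I J ℝ) :
    ∃ x : J → ℝ, (∀ j, x j = 1 ∨ x j = -1) ∧ disc A = ⨆ i, |A.mulVec x i| :=
  Set.Nonempty.csInf_mem
    (s := {d : ℝ | ∃ x : J → ℝ, (∀ j, x j = 1 ∨ x j = -1) ∧ d = ⨆ i, |A.mulVec x i|})
    ⟨_, fun _ => 1, fun _ => Or.inl rfl, rfl⟩ (finite_setOf_signing_discrepancy A)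

theorem disc_nonneg {I J : Type*} [Fintype I] [Fintype J] (A : Matrix I J ℝ) : 0 ≤ disc A := by
  obtain ⟨x, -, hx⟩ := exists_signing_eq_disc A
  rw [hx]
  exact Real.iSup_nonneg fun _ => abs_nonneg _

theorem disc_submatrix_le_herdisc {m n : ℕ} (A : Matrix (Fin m) (Fin n) ℝ) (S : Finset (Fin n)) :
    disc (A.submatrix id (fun j : {j // j ∈ S} => (j : Fin n))) ≤ herdisc A := by
  refine le_csSup (Set.Finite.bddAbove ?_) ⟨S, rfl⟩
  refine (Set.finite_range fun S : Finset (Fin n) =>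
    disc (A.submatrix id (fun j : {j // j ∈ S} => (j : Fin n)))).subset ?_
  rintro d ⟨S, rfl⟩
  exact ⟨S, rfl⟩

theorem herdisc_nonneg {m n : ℕ} (A : Matrix (Fin m) (Fin n) ℝ) : 0 ≤ herdisc A :=
  (disc_nonneg _).trans (disc_submatrix_le_herdisc A ∅)

theorem exists_signing_le_herdisc {m n : ℕ} (A : Matrix (Fin m) (Fin n) ℝ) (S : Finset (Fin n)) :
    ∃ x : Fin n → ℤ, (∀ j ∈ S, x j = 1 ∨ x j = -1) ∧ (∀ j ∉ S, x j = 0) ∧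
      ∀ i, |A.mulVec (fun j => (x j : ℝ)) i| ≤ herdisc A := by
  obtain ⟨y, hy, hdisc⟩ :=
    exists_signing_eq_disc (A.submatrix id (fun j : {j // j ∈ S} => (j : Fin n)))
  have hy' (j : {j // j ∈ S}) : ∃ a : ℤ, (a = 1 ∨ a = -1) ∧ (a : ℝ) = y j := by
    rcases hy j with h | h
    · exact ⟨1, by simp [h]⟩
    · exact ⟨-1, by simp [h]⟩
  choose a ha hay using hy'
  refine ⟨fun j => if hj : j ∈ S then a ⟨j, hj⟩ else 0, fun j hj => ?_, fun j hj => ?_,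
    fun i => ?_⟩
  · simpa [hj] using ha ⟨j, hj⟩
  · simp [hj]
  · have e : A.mulVec (fun j => (((if hj : j ∈ S then a ⟨j, hj⟩ else 0 : ℤ)) : ℝ)) i
        = (A.submatrix id (fun j : {j // j ∈ S} => (j : Fin n))).mulVec y i := by
      simp only [Matrix.mulVec, dotProduct, Matrix.submatrix_apply, id]
      rw [← Finset.sum_subset (Finset.subset_univ S) (by intro j _ hj; simp [hj]),
        ← Finset.sum_coe_sort S]
      refine Finset.sum_congr rfl fun j _ => ?_
      simp [hay]
    rw [e]
    refine le_trans ?_ (disc_submatrix_le_herdisc A S)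
    rw [hdisc]
    exact le_ciSup
      (f := fun i => |(A.submatrix id (fun j : {j // j ∈ S} => (j : Fin n))).mulVec y i|)
      (Set.finite_range _).bddAbove i

/-- The determinant lower bound of Lovász, Spencer and Vesztergombi. -/
theorem abs_det_submatrix_le_herdisc {m n : ℕ} (A : Matrix (Fin m) (Fin n) ℝ) {K : Type*}
    [Fintype K] [DecidableEq K] (f : K → Fin m) (g : K → Fin n) :
    |(A.submatrix f g).det| ≤ (2 * herdisc A) ^ Fintype.card K := by
  have h0 := herdisc_nonneg A
  by_cases hg : Function.Injective g
  · refine Matrix.abs_det_le_of_forall_exists_signing _ h0 fun S => ?_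
    classical
    obtain ⟨x, hx1, hx0, hx⟩ := exists_signing_le_herdisc A (S.toFinset.image g)
    refine ⟨x ∘ g, fun j hj => hx1 _ ?_, fun j hj => hx0 _ ?_, fun i => ?_⟩
    · exact Finset.mem_image_of_mem g (Set.mem_toFinset.mpr hj)
    · simpa [hg.eq_iff] using hj
    · have e : (A.submatrix f g).mulVec (fun j => (((x ∘ g) j : ℤ) : ℝ)) i
          = A.mulVec (fun j => (x j : ℝ)) (f i) := by
        simp only [Matrix.mulVec, dotProduct, Matrix.submatrix_apply, Function.comp_apply]
        rw [← Finset.sum_image (s := Finset.univ) (g := g) (f := fun j => A (f i) j * (x j : ℝ))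
          hg.injOn]
        refine Finset.sum_subset (Finset.subset_univ _) fun j _ hj => ?_
        rw [hx0 j fun hj' => hj (Finset.image_subset_image (Finset.subset_univ _) hj')]
        simp
      rw [e]
      exact hx (f i)
  · simp only [Function.Injective, not_forall] at hg
    obtain ⟨a, b, hab, hne⟩ := hg
    rw [Matrix.det_zero_of_column_eq hne (by simp [hab]), abs_zero]
    positivity

/-- for eigenvalues `λ_1 ≥ ⋯ ≥ λ_n ≥ 0` of `AᵀA` (with an orthonormal
eigenbasis `η`), for every positive `k ≤ min n m`,
`herdisc A ≥ (k/(2e))·√(λ_k/(m·n))`. -/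
theorem stmt0 (m n : ℕ) (A : Matrix (Fin m) (Fin n) ℝ)
    (lam : Fin n → ℝ) (η : Fin n → Fin n → ℝ)
    (hanti : ∀ i j : Fin n, i ≤ j → lam j ≤ lam i)
    (hnonneg : ∀ i, 0 ≤ lam i)
    (hortho : ∀ i j : Fin n, (∑ t, η i t * η j t) = if i = j then 1 else 0)
    (heig : ∀ i : Fin n, (Aᵀ * A).mulVec (η i) = lam i • η i)
    (k : ℕ) (hk1 : 1 ≤ k) (hkn : k ≤ n) (hkm : k ≤ m) :
    herdisc A ≥ ((k : ℝ) / (2 * Real.exp 1)) *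
      Real.sqrt (lam ⟨k - 1, by omega⟩ / (m * n)) := by
  set l : ℝ := lam ⟨k - 1, by omega⟩ with hl
  set h := herdisc A with hh
  have h0 : 0 ≤ h := herdisc_nonneg A
  have hl0 : 0 ≤ l := hnonneg _
  have hm : (0 : ℝ) < m := by exact_mod_cast (by omega : 0 < m)
  have hn : (0 : ℝ) < n := by exact_mod_cast (by omega : 0 < n)
  set V : Matrix (Fin n) (Fin k) ℝ := Matrix.of fun t i => η (Fin.castLE hkn i) t with hVdef
  have hV : Vᵀ * V = 1 := by
    ext i j
    simp only [Matrix.mul_apply, Matrix.transpose_apply, hVdef, Matrix.of_apply, hortho,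
      Matrix.one_apply, Fin.castLE_inj]
  have hAV : (A * V)ᵀ * (A * V) = Matrix.diagonal fun i => lam (Fin.castLE hkn i) := by
    have e : (Aᵀ * A) * V = V * Matrix.diagonal fun i => lam (Fin.castLE hkn i) := by
      ext t i
      rw [Matrix.mul_diagonal]
      have := congrFun (heig (Fin.castLE hkn i)) t
      rw [Pi.smul_apply, smul_eq_mul, mul_comm] at this
      exact this
    rw [Matrix.transpose_mul, Matrix.mul_assoc, ← Matrix.mul_assoc Aᵀ, e, ← Matrix.mul_assoc, hV,
      Matrix.one_mul]
  have hdet : l ^ k ≤ ((A * V)ᵀ * (A * V)).det := by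
    rw [hAV, Matrix.det_diagonal]
    calc l ^ k = ∏ _i : Fin k, l := by simp
      _ ≤ _ := Finset.prod_le_prod (fun _ _ => hl0) fun i _ =>
        hanti _ _ (Fin.le_def.mpr (by simp only [Fin.val_castLE]; omega))
  have hmain : (k.factorial : ℝ) ^ 2 * l ^ k ≤ (m : ℝ) ^ k * (n : ℝ) ^ k * (2 * h) ^ (2 * k) := by
    have h1 := Matrix.factorial_sq_mul_det_le_sum_sq_det A V hV
    rw [Fintype.card_fin] at h1
    calc (k.factorial : ℝ) ^ 2 * l ^ k
        ≤ (k.factorial : ℝ) ^ 2 * ((A * V)ᵀ * (A * V)).det := by gcongr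
      _ ≤ _ := h1
      _ ≤ ∑ _f : Fin k → Fin m, ∑ _g : Fin k → Fin n, (2 * h) ^ (2 * k) := by
          refine Finset.sum_le_sum fun f _ => Finset.sum_le_sum fun g _ => ?_
          have := abs_det_submatrix_le_herdisc A f g
          rw [Fintype.card_fin] at this
          rw [← sq_abs, mul_comm 2 k, pow_mul]
          gcongr
      _ = _ := by simp [mul_assoc]
  have hfac : ((k : ℝ) / Real.exp 1) ^ k ≤ k.factorial := by
    have := Real.pow_div_factorial_le_exp k (Nat.cast_nonneg k) k
    rw [div_le_iff₀ (by positivity)] at this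
    rw [div_pow, ← Real.exp_nat_mul, mul_one, div_le_iff₀ (Real.exp_pos _)]
    linarith
  refine le_of_pow_le_pow_left₀ (n := 2 * k) (by omega) h0 ?_
  have hfin : ((k : ℝ) / Real.exp 1) ^ (2 * k) * l ^ k
      ≤ (m : ℝ) ^ k * (n : ℝ) ^ k * (2 * h) ^ (2 * k) := by
    refine le_trans ?_ hmain
    rw [mul_comm 2 k, pow_mul]
    gcongr
  have e : ((k : ℝ) / (2 * Real.exp 1) * Real.sqrt (l / (m * n))) ^ (2 * k)
      = ((k : ℝ) / Real.exp 1) ^ (2 * k) * l ^ k / (2 ^ (2 * k) * ((m : ℝ) ^ k * (n : ℝ) ^ k)) := by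
    rw [mul_pow, pow_mul (Real.sqrt _), Real.sq_sqrt (by positivity), div_pow l, mul_pow (m : ℝ),
      mul_comm (2 : ℝ), ← div_div, div_pow _ (2 : ℝ)]
    field_simp
  rw [e, div_le_iff₀ (by positivity)]
  refine hfin.trans (le_of_eq ?_)
  rw [mul_pow]
  ring
end

section
/- There is a universal constant C > 0 such that for every real matrix A ∈ ℝ^{m×n} with m ≥ n, there exists an integer ℓ ≤ n/4 and a matrix V ∈ ℝ^{ℓ×n} with orthonormal rows such that every row of A(I − VᵀV) has Euclidean norm at most C·herdisc(A)·log₂(2m/n); in fact one may take the bound 48e·log₂(8m/n)·herdisc(A). -/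
open Matrix

/-- `A` has the property that every subset of its columns can be signed with all row sums
bounded by `h` in absolute value. -/
def HasSignings {I J : Type*} [Fintype J] (A : Matrix I J ℝ) (h : ℝ) : Prop :=
  ∀ S : Finset J, ∃ x : J → ℝ, (∀ j ∈ S, x j = 1 ∨ x j = -1) ∧ (∀ j ∉ S, x j = 0) ∧
    ∀ i, |(A *ᵥ x) i| ≤ h

theorem exists_signing_le_disc {I J : Type*} [Fintype I] [Fintype J] (A : Matrix I J ℝ) :
    ∃ x : J → ℝ, (∀ j, x j = 1 ∨ x j = -1) ∧ ∀ i, |(A *ᵥ x) i| ≤ disc A := by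
  have hfin : {x : J → ℝ | ∀ j, x j = 1 ∨ x j = -1}.Finite := by
    have : {x : J → ℝ | ∀ j, x j = 1 ∨ x j = -1} =
        Set.pi Set.univ (fun _ => ({1, -1} : Set ℝ)) := by
      ext x; simp
    rw [this]
    exact Set.Finite.pi' (fun _ => by simp) |>.subset (fun x hx j => hx j trivial)
  have hset : {d : ℝ | ∃ x : J → ℝ, (∀ j, x j = 1 ∨ x j = -1) ∧ d = ⨆ i, |A.mulVec x i|} =
      (fun x : J → ℝ => ⨆ i, |A.mulVec x i|) '' {x : J → ℝ | ∀ j, x j = 1 ∨ x j = -1} := by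
    ext d
    simp only [Set.mem_ofPred_eq, Set.mem_image, eq_comm]
  have hmem : disc A ∈ {d : ℝ | ∃ x : J → ℝ, (∀ j, x j = 1 ∨ x j = -1) ∧
      d = ⨆ i, |A.mulVec x i|} := by
    apply Set.Nonempty.csInf_mem
    · exact ⟨_, fun _ => 1, by simp, rfl⟩
    · rw [hset]; exact hfin.image _
  obtain ⟨x, hx, hd⟩ := hmem
  refine ⟨x, hx, fun i => ?_⟩
  rw [hd]
  exact le_ciSup (f := fun i => |A.mulVec x i|) (Set.finite_range _).bddAbove i

theorem hasSignings_herdisc {m n : ℕ} (A : Matrix (Fin m) (Fin n) ℝ) :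
    HasSignings A (herdisc A) := by
  intro S
  obtain ⟨x, hx, hd⟩ := exists_signing_le_disc
    (A.submatrix id (fun j : {j // j ∈ S} => (j : Fin n)))
  have hle : disc (A.submatrix id (fun j : {j // j ∈ S} => (j : Fin n))) ≤ herdisc A := by
    apply le_csSup
    · have : {d : ℝ | ∃ S : Finset (Fin n),
          d = disc (A.submatrix id (fun j : {j // j ∈ S} => (j : Fin n)))} =
          Set.range (fun S : Finset (Fin n) =>
            disc (A.submatrix id (fun j : {j // j ∈ S} => (j : Fin n)))) := by
        ext d; simp only [Set.mem_ofPred_eq, Set.mem_range, eq_comm]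
      rw [this]
      exact (Set.finite_range _).bddAbove
    · exact ⟨S, rfl⟩
  refine ⟨fun j => if hj : j ∈ S then x ⟨j, hj⟩ else 0, fun j hj => by simpa [hj] using hx ⟨j, hj⟩,
    fun j hj => by simp [hj], fun i => le_trans (le_of_eq ?_) ((hd i).trans hle)⟩
  congr 1
  simp only [mulVec, dotProduct, submatrix_apply, id]
  rw [← Finset.sum_subset (Finset.subset_univ S) (fun j _ hj => by simp [hj]),
    ← Finset.sum_coe_sort]
  exact Finset.sum_congr rfl fun j _ => by simp

theorem HasSignings.submatrix {I J K L : Type*} [Fintype J] [Fintype L] [DecidableEq J]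
    {A : Matrix I J ℝ} {h : ℝ} (hA : HasSignings A h) (g : K → I) {f : L → J}
    (hf : Function.Injective f) : HasSignings (A.submatrix g f) h := by
  intro S
  obtain ⟨x, h1, h0, hx⟩ := hA (S.map ⟨f, hf⟩)
  refine ⟨x ∘ f, fun j hj => h1 _ (Finset.mem_map_of_mem ⟨f, hf⟩ hj), fun j hj => h0 _ ?_, fun i => ?_⟩
  · simpa [hf.eq_iff] using hj
  · convert hx (g i) using 2
    simp only [mulVec, dotProduct, submatrix_apply, Function.comp]
    have e1 : ∑ j, A (g i) j * x j = ∑ j ∈ S.map ⟨f, hf⟩, A (g i) j * x j :=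
      (Finset.sum_subset (Finset.subset_univ _) (fun j _ hj => by rw [h0 j hj, mul_zero])).symm
    rw [e1, Finset.sum_map]
    refine (Finset.sum_subset (Finset.subset_univ _) (fun j _ hj => ?_)).symm
    have : x (f j) = 0 := h0 _ (by simpa [hf.eq_iff] using hj)
    simp [this]

/-- Rounding a dyadic vector to a `0/1` vector, one bit at a time. -/
theorem HasSignings.exists_round_dyadic {I J : Type*} [Fintype J]
    {A : Matrix I J ℝ} {h : ℝ} (hA : HasSignings A h) (N : ℕ) :
    ∀ w : J → ℕ, (∀ j, w j ≤ 2 ^ N) → ∃ x : J → Fin 2, ∀ i,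
      |(A *ᵥ (fun j => ((x j : ℕ) : ℝ) - w j / 2 ^ N)) i| ≤ (1 - 1 / 2 ^ N) * h := by
  induction N with
  | zero =>
    intro w hw
    refine ⟨fun j => ⟨w j, by have := hw j; simp at this; omega⟩, fun i => ?_⟩
    simp [mulVec, dotProduct]
  | succ N ih =>
    intro w hw
    obtain ⟨y, h1, h0, hy⟩ := hA (Finset.univ.filter fun j => w j % 2 = 1)
    have hex : ∀ j, ∃ v : ℕ, v ≤ 2 ^ N ∧ (2 * v : ℝ) = w j + y j := by
      intro j
      have hj := hw j
      rw [pow_succ] at hj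
      by_cases hodd : w j % 2 = 1
      · rcases h1 j (by simpa using hodd) with e | e
        · refine ⟨(w j + 1) / 2, by omega, ?_⟩
          rw [e]
          exact_mod_cast (by omega : 2 * ((w j + 1) / 2) = w j + 1)
        · refine ⟨(w j - 1) / 2, by omega, ?_⟩
          rw [e]
          have : 2 * ((w j - 1) / 2) + 1 = w j := by omega
          have : (2 * ((w j - 1) / 2 : ℕ) + 1 : ℝ) = w j := by exact_mod_cast this
          linarith
      · refine ⟨w j / 2, by omega, ?_⟩
        rw [h0 j (by simpa using hodd), add_zero]
        exact_mod_cast (by omega : 2 * (w j / 2) = w j)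
    choose v hv hvy using hex
    obtain ⟨x, hx⟩ := ih v hv
    refine ⟨x, fun i => ?_⟩
    have hsplit : (fun j => ((x j : ℕ) : ℝ) - w j / 2 ^ (N + 1)) =
        (fun j => ((x j : ℕ) : ℝ) - v j / 2 ^ N) + (1 / 2 ^ (N + 1) : ℝ) • y := by
      ext j
      have : (v j : ℝ) = (w j + y j) / 2 := by linarith [hvy j]
      simp only [Pi.add_apply, Pi.smul_apply, smul_eq_mul, this]
      field_simp
      ring
    rw [hsplit, mulVec_add, mulVec_smul, Pi.add_apply, Pi.smul_apply, smul_eq_mul]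
    have hp : (0 : ℝ) < 1 / 2 ^ (N + 1) := by positivity
    calc _ ≤ |(A *ᵥ (fun j => ((x j : ℕ) : ℝ) - v j / 2 ^ N)) i|
            + |1 / 2 ^ (N + 1) * (A *ᵥ y) i| := abs_add_le _ _
      _ ≤ (1 - 1 / 2 ^ N) * h + 1 / 2 ^ (N + 1) * h := by
          rw [abs_mul, abs_of_pos hp]
          gcongr
          · exact hx i
          · exact hy i
      _ = _ := by field_simp; ring

/-- Linear discrepancy is bounded by hereditary discrepancy. -/
theorem HasSignings.exists_round {I J : Type*} [Fintype I] [Fintype J]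
    {A : Matrix I J ℝ} {h : ℝ} (hA : HasSignings A h) (hh : 0 ≤ h)
    (w : J → ℝ) (hw : w ∈ Set.Icc (0 : J → ℝ) 1) :
    ∃ x : J → Fin 2, A *ᵥ w ∈ Metric.closedBall (A *ᵥ fun j => ((x j : ℕ) : ℝ)) h := by
  have hcont : Continuous fun v : J → ℝ => A *ᵥ v := by fun_prop
  have hclosed : IsClosed (⋃ x : J → Fin 2, (fun v : J → ℝ => A *ᵥ v) ⁻¹'
      Metric.closedBall (A *ᵥ fun j => ((x j : ℕ) : ℝ)) h) :=
    isClosed_iUnion_of_finite fun x => Metric.isClosed_closedBall.preimage hcont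
  have hlim : Filter.Tendsto (fun N : ℕ => fun j => ((⌊w j * 2 ^ N⌋₊ : ℕ) : ℝ) / 2 ^ N)
      Filter.atTop (nhds w) := by
    rw [tendsto_pi_nhds]
    intro j
    exact (tendsto_nat_floor_mul_div_atTop (hw.1 j)).comp
      (tendsto_pow_atTop_atTop_of_one_lt (one_lt_two : (1 : ℝ) < 2))
  have hmem := hclosed.mem_of_tendsto hlim (Filter.Eventually.of_forall fun N => ?_)
  · simpa using hmem
  · obtain ⟨x, hx⟩ := hA.exists_round_dyadic N (fun j => ⌊w j * 2 ^ N⌋₊) (fun j => by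
      apply Nat.floor_le_of_le
      push_cast
      exact mul_le_of_le_one_left (by positivity) (hw.2 j))
    refine Set.mem_iUnion.2 ⟨x, ?_⟩
    rw [Set.mem_preimage, Metric.mem_closedBall, dist_comm, dist_pi_le_iff hh]
    intro i
    rw [Real.dist_eq, ← Pi.sub_apply, ← mulVec_sub]
    refine (hx i).trans ?_
    have : (0 : ℝ) ≤ 1 / 2 ^ N := by positivity
    nlinarith

/-- A volumetric form of the determinant lower bound for hereditary discrepancy. -/
theorem HasSignings.abs_det_le {k : ℕ} {B : Matrix (Fin k) (Fin k) ℝ} {h : ℝ}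
    (hB : HasSignings B h) (hh : 0 ≤ h) : |B.det| ≤ (4 * h) ^ k := by
  rcases eq_or_ne B.det 0 with hdet | hdet
  · rw [hdet, abs_zero]; positivity
  have hdet' : LinearMap.det (toLin' B) ≠ 0 := by rwa [LinearMap.det_toLin']
  have hcover : Set.Icc (0 : Fin k → ℝ) 1 ⊆ ⋃ x : Fin k → Fin 2,
      toLin' B ⁻¹' Metric.closedBall (B *ᵥ fun j => ((x j : ℕ) : ℝ)) h := by
    intro w hw
    simpa using hB.exists_round hh w hw
  have hvol : (1 : ENNReal) ≤ ENNReal.ofReal (2 ^ k * (|B.det|⁻¹ * (2 * h) ^ k)) := by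
    calc (1 : ENNReal) = MeasureTheory.volume (Set.Icc (0 : Fin k → ℝ) 1) := by
          simp [Real.volume_Icc_pi]
      _ ≤ ∑ x : Fin k → Fin 2, MeasureTheory.volume
            (toLin' B ⁻¹' Metric.closedBall (B *ᵥ fun j => ((x j : ℕ) : ℝ)) h) :=
          (MeasureTheory.measure_mono hcover).trans (MeasureTheory.measure_iUnion_fintype_le _ _)
      _ = ∑ x : Fin k → Fin 2, ENNReal.ofReal (|B.det|⁻¹ * (2 * h) ^ k) := by
          refine Finset.sum_congr rfl fun x _ => ?_
          rw [MeasureTheory.Measure.addHaar_preimage_linearMap _ hdet', LinearMap.det_toLin',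
            Real.volume_pi_closedBall _ hh, ← ENNReal.ofReal_mul (abs_nonneg _), abs_inv,
            Fintype.card_fin]
      _ = _ := by
          rw [Finset.sum_const, nsmul_eq_mul, ENNReal.ofReal_mul (by positivity)]
          simp [ENNReal.ofReal_pow]
  have hreal := ENNReal.one_le_ofReal.1 hvol
  have hpos : 0 < |B.det| := abs_pos.2 hdet
  calc |B.det| = |B.det| * 1 := (mul_one _).symm
    _ ≤ |B.det| * (2 ^ k * (|B.det|⁻¹ * (2 * h) ^ k)) := by gcongr
    _ = (2 * (2 * h)) ^ k := by rw [mul_pow 2 (2 * h)]; field_simp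
    _ = (4 * h) ^ k := by ring

/-- An unordered form of the Cauchy–Binet formula for a Gram determinant. -/
theorem factorial_mul_det_mul_transpose {ι J : Type*} [Fintype ι] [DecidableEq ι] [Fintype J]
    [DecidableEq J] (V : Matrix ι J ℝ) :
    ((Fintype.card ι).factorial : ℝ) * (V * Vᵀ).det =
      ∑ f : ι → J, (V.submatrix id f).det ^ 2 := by
  have hexp : (V * Vᵀ).det = ∑ f : ι → J, (∏ i, V i (f i)) * (V.submatrix id f).det := by
    have hrow : (V * Vᵀ : Matrix ι ι ℝ) = fun i => ∑ j, V i j • Vᵀ j := by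
      ext i l
      simp [mul_apply, Finset.sum_apply]
    rw [hrow]
    change (detRowAlternating (R := ℝ) (n := ι)).toMultilinearMap _ = _
    rw [MultilinearMap.map_sum]
    refine Finset.sum_congr rfl fun f _ => ?_
    rw [MultilinearMap.map_smul_univ, smul_eq_mul]
    congr 1
    rw [← det_transpose (V.submatrix id f)]
    rfl
  have hperm : ∀ σ : Equiv.Perm ι, (V * Vᵀ).det = ∑ f : ι → J,
      ((Equiv.Perm.sign σ : ℤ) : ℝ) * (∏ i, V i (f (σ i))) * (V.submatrix id f).det := by
    intro σ
    rw [hexp, ← (Equiv.arrowCongr σ (Equiv.refl J)).symm.sum_comp]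
    refine Finset.sum_congr rfl fun f _ => ?_
    have : V.submatrix id ((Equiv.arrowCongr σ (Equiv.refl J)).symm f) =
        (V.submatrix id f).submatrix id σ := by
      ext i j; simp [Equiv.arrowCongr]
    rw [this, det_permute']
    simp [Equiv.arrowCongr]
    ring
  calc ((Fintype.card ι).factorial : ℝ) * (V * Vᵀ).det
      = ∑ _σ : Equiv.Perm ι, (V * Vᵀ).det := by
        rw [Finset.sum_const, nsmul_eq_mul, Finset.card_univ, Fintype.card_perm]
    _ = ∑ σ : Equiv.Perm ι, ∑ f : ι → J,
      ((Equiv.Perm.sign σ : ℤ) : ℝ) * (∏ i, V i (f (σ i))) * (V.submatrix id f).det :=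
        Finset.sum_congr rfl fun σ _ => hperm σ
    _ = _ := by
        rw [Finset.sum_comm]
        refine Finset.sum_congr rfl fun f _ => ?_
        rw [← Finset.sum_mul, sq]
        congr 1
        rw [← det_transpose, det_apply']
        rfl

/-- A matrix with orthonormal rows has a maximal minor which is not too small. -/
theorem exists_one_le_two_pow_mul_det_sq {k n : ℕ} (V : Matrix (Fin k) (Fin n) ℝ)
    (hV : V * Vᵀ = 1) :
    ∃ f : Fin k → Fin n, Function.Injective f ∧ 1 ≤ 2 ^ n * (V.submatrix id f).det ^ 2 := by
  by_contra! hcon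
  have hsum := factorial_mul_det_mul_transpose V
  rw [hV, det_one, mul_one, Fintype.card_fin] at hsum
  have hzero : ∀ f : Fin k → Fin n, ¬ Function.Injective f → (V.submatrix id f).det ^ 2 = 0 := by
    intro f hf
    simp only [Function.Injective, not_forall] at hf
    obtain ⟨a, b, hab, hne⟩ := hf
    rw [det_zero_of_column_eq hne (fun i => by simp [hab])]
    simp
  rw [← Finset.sum_filter_of_ne (p := Function.Injective)
    (fun f _ hne => by by_contra hf; exact hne (hzero f hf))] at hsum
  have hcard : (Finset.univ.filter fun f : Fin k → Fin n => Function.Injective f).card =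
      n.descFactorial k := by
    rw [← Fintype.card_subtype, Fintype.card_congr (Equiv.subtypeInjectiveEquivEmbedding _ _),
      Fintype.card_embedding_eq, Fintype.card_fin, Fintype.card_fin]
  have hne : (Finset.univ.filter fun f : Fin k → Fin n => Function.Injective f).Nonempty := by
    rw [Finset.nonempty_iff_ne_empty]
    intro he
    rw [he, Finset.sum_empty] at hsum
    exact (Nat.cast_ne_zero (R := ℝ)).2 k.factorial_ne_zero hsum
  have hlt : (2 : ℝ) ^ n * k.factorial < n.descFactorial k := by
    rw [hsum, Finset.mul_sum]
    calc _ < ∑ f ∈ Finset.univ.filter fun f : Fin k → Fin n => Function.Injective f, (1 : ℝ) :=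
          Finset.sum_lt_sum_of_nonempty hne fun f hf => hcon f (Finset.mem_filter.1 hf).2
      _ = _ := by rw [Finset.sum_const, hcard, nsmul_eq_mul, mul_one]
  have hle : n.descFactorial k ≤ 2 ^ n * k.factorial := by
    rw [Nat.descFactorial_eq_factorial_mul_choose, mul_comm]
    exact Nat.mul_le_mul_right _ (Nat.choose_le_two_pow n k)
  have : (n.descFactorial k : ℝ) ≤ 2 ^ n * k.factorial := by exact_mod_cast hle
  linarith

/-- Adjoining to an orthonormal system the normalized residual of one more row of `A`. -/
theorem exists_orthonormal_extension {m n k : ℕ} {A : Matrix (Fin m) (Fin n) ℝ} {D : ℝ}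
    {g : Fin k → Fin m} {V : Matrix (Fin k) (Fin n) ℝ} {T : Matrix (Fin k) (Fin k) ℝ}
    (hD : 0 ≤ D) (hV : V * Vᵀ = 1) (hT : A.submatrix g id = T * V) (hdet : T.det ≠ 0)
    (hDT : D ^ k ≤ |T.det|) (i : Fin m)
    (hi : D < Real.sqrt (∑ j, ((A * ((1 : Matrix (Fin n) (Fin n) ℝ) - Vᵀ * V)) i j) ^ 2)) :
    ∃ (g' : Fin (k + 1) → Fin m) (V' : Matrix (Fin (k + 1)) (Fin n) ℝ)
      (T' : Matrix (Fin (k + 1)) (Fin (k + 1)) ℝ), V' * V'ᵀ = 1 ∧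
      A.submatrix g' id = T' * V' ∧ T'.det ≠ 0 ∧ D ^ (k + 1) ≤ |T'.det| := by
  set a : Matrix (Fin 1) (Fin n) ℝ := A.submatrix (fun _ => i) id with ha
  set u : Matrix (Fin 1) (Fin n) ℝ := a * (1 - Vᵀ * V) with hu
  set s : ℝ := Real.sqrt (∑ j, ((A * ((1 : Matrix (Fin n) (Fin n) ℝ) - Vᵀ * V)) i j) ^ 2) with hs
  have hs0 : 0 < s := hD.trans_lt hi
  have huV : u * Vᵀ = 0 := by
    rw [hu, Matrix.mul_assoc, Matrix.sub_mul, Matrix.mul_assoc, hV]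
    simp
  have hVu : V * uᵀ = 0 := by
    have := congrArg transpose huV
    simpa using this
  have huu : u * uᵀ = (s ^ 2) • (1 : Matrix (Fin 1) (Fin 1) ℝ) := by
    ext p q
    rw [Subsingleton.elim p 0, Subsingleton.elim q 0, hs, Real.sq_sqrt (by positivity)]
    rw [mul_apply, Matrix.smul_apply, one_apply_eq, smul_eq_mul, mul_one]
    refine Finset.sum_congr rfl fun j _ => ?_
    rw [sq]
    rfl
  have hau : a = (a * Vᵀ) * V + u := by
    rw [hu, Matrix.mul_sub, Matrix.mul_one, ← Matrix.mul_assoc]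
    abel
  let e : Fin (k + 1) ≃ Fin k ⊕ Fin 1 := finSumFinEquiv.symm
  let W : Matrix (Fin k ⊕ Fin 1) (Fin n) ℝ := fromRows V (s⁻¹ • u)
  let U : Matrix (Fin k ⊕ Fin 1) (Fin k ⊕ Fin 1) ℝ := fromBlocks T 0 (a * Vᵀ) (s • 1)
  have hW : W * Wᵀ = 1 := by
    simp only [W, transpose_fromRows, fromRows_mul_fromCols, hV, transpose_smul, Matrix.mul_smul,
      Matrix.smul_mul, huV, hVu, huu, smul_zero, smul_smul]
    rw [show s⁻¹ * (s⁻¹ * s ^ 2) = 1 by field_simp, one_smul, fromBlocks_one]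
  have hUW : A.submatrix (Sum.elim g fun _ => i) id = U * W := by
    have hlast : a * Vᵀ * V + (s • (1 : Matrix (Fin 1) (Fin 1) ℝ)) * (s⁻¹ • u) = a := by
      rw [Matrix.smul_mul, Matrix.one_mul, smul_smul, mul_inv_cancel₀ hs0.ne', one_smul, ← hau]
    simp only [U, W, fromBlocks_mul_fromRows, hlast, Matrix.zero_mul, add_zero, ← hT]
    ext (p | p) q <;> simp [ha]
  have hU : U.det = T.det * s := by
    simp [U, det_fromBlocks_zero₁₂]
  refine ⟨(Sum.elim g fun _ => i) ∘ e, W.submatrix e id, U.submatrix e e, ?_, ?_, ?_, ?_⟩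
  · have := submatrix_mul_equiv W Wᵀ e (Equiv.refl _) e
    rw [hW, submatrix_one_equiv] at this
    exact this
  · rw [submatrix_mul_equiv, ← hUW]
    rfl
  · rw [det_submatrix_equiv_self, hU]
    exact mul_ne_zero hdet hs0.ne'
  · rw [det_submatrix_equiv_self, hU, abs_mul, abs_of_pos hs0, pow_succ]
    gcongr

/-- After projecting out a suitable subspace of dimension at most `n / 4`, every row of `A` has
norm at most `16 * h`. -/
theorem HasSignings.exists_projection {m n : ℕ} {A : Matrix (Fin m) (Fin n) ℝ} {h : ℝ}
    (hA : HasSignings A h) (hh : 0 ≤ h) :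
    ∃ (ℓ : ℕ) (V : Matrix (Fin ℓ) (Fin n) ℝ), 4 * ℓ ≤ n ∧ V * Vᵀ = 1 ∧
      ∀ i : Fin m, Real.sqrt (∑ j, ((A * ((1 : Matrix (Fin n) (Fin n) ℝ) - Vᵀ * V)) i j) ^ 2)
        ≤ 16 * h := by
  by_contra! hcon
  have hD : 0 ≤ 16 * h := by positivity
  have hseq : ∀ k : ℕ, 4 * k ≤ n + 4 → ∃ (g : Fin k → Fin m) (V : Matrix (Fin k) (Fin n) ℝ)
      (T : Matrix (Fin k) (Fin k) ℝ), V * Vᵀ = 1 ∧ A.submatrix g id = T * V ∧ T.det ≠ 0 ∧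
      (16 * h) ^ k ≤ |T.det| := by
    intro k
    induction k with
    | zero => exact fun _ => ⟨Fin.elim0, 0, 1, Subsingleton.elim _ _, Subsingleton.elim _ _,
        by simp, by simp⟩
    | succ k ih =>
      intro hk
      obtain ⟨g, V, T, hV, hT, hdet, hDT⟩ := ih (by omega)
      obtain ⟨i, hi⟩ := hcon k V (by omega) hV
      exact exists_orthonormal_extension hD hV hT hdet hDT i hi
  obtain ⟨k, hk, hk'⟩ : ∃ k : ℕ, n < 4 * k ∧ 4 * k ≤ n + 4 := ⟨n / 4 + 1, by omega, by omega⟩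
  obtain ⟨g, V, T, hV, hT, hdet, hDT⟩ := hseq k hk'
  obtain ⟨f, hf, hVf⟩ := exists_one_le_two_pow_mul_det_sq V hV
  have hB := (hA.submatrix g hf).abs_det_le hh
  have hprod : A.submatrix g f = T * V.submatrix id f := by
    exact congrArg (fun M : Matrix (Fin k) (Fin n) ℝ => M.submatrix id f) hT
  rw [hprod, det_mul] at hB
  have hTsq : T.det ^ 2 ≤ 2 ^ n * ((4 * h) ^ k) ^ 2 := by
    calc T.det ^ 2 = T.det ^ 2 * 1 := (mul_one _).symm
      _ ≤ T.det ^ 2 * (2 ^ n * (V.submatrix id f).det ^ 2) := by gcongr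
      _ = 2 ^ n * |T.det * (V.submatrix id f).det| ^ 2 := by rw [sq_abs]; ring
      _ ≤ _ := by gcongr
  have hTpos : 0 < T.det ^ 2 := by positivity
  have hhk : 0 < ((4 * h) ^ k) ^ 2 := by
    by_contra hle
    have : (2 : ℝ) ^ n * ((4 * h) ^ k) ^ 2 ≤ 0 :=
      mul_nonpos_of_nonneg_of_nonpos (by positivity) (not_lt.1 hle)
    linarith
  have hpow : (2 : ℝ) ^ n < 2 ^ (4 * k) := pow_lt_pow_right₀ one_lt_two (by omega)
  have hDsq : ((16 * h) ^ k) ^ 2 ≤ T.det ^ 2 := by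
    rw [← sq_abs T.det]
    gcongr
  have hid : ((16 * h) ^ k) ^ 2 = 2 ^ (4 * k) * ((4 * h) ^ k) ^ 2 := by
    rw [pow_mul, pow_right_comm (16 * h), pow_right_comm (4 * h), ← mul_pow]
    congr 1
    ring
  nlinarith [mul_lt_mul_of_pos_right hpow hhk]

/-- there is a universal `C > 0` such that for every `A ∈ ℝ^{m×n}` with
`m ≥ n` there are `ℓ ≤ n/4` and a matrix `V ∈ ℝ^{ℓ×n}` with orthonormal rows such that
every row of `A(I - VᵀV)` has Euclidean norm at most `C·herdisc(A)·log₂(2m/n)`;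
in fact the bound `48e·log₂(8m/n)·herdisc(A)` holds. -/
theorem stmt1 : ∃ C : ℝ, C > 0 ∧
    ∀ (m n : ℕ) (A : Matrix (Fin m) (Fin n) ℝ), n ≤ m →
      ∃ (ℓ : ℕ) (V : Matrix (Fin ℓ) (Fin n) ℝ), 4 * ℓ ≤ n ∧ V * Vᵀ = 1 ∧
        (∀ i : Fin m, Real.sqrt (∑ j, ((A * ((1 : Matrix (Fin n) (Fin n) ℝ) - Vᵀ * V)) i j) ^ 2)
          ≤ C * herdisc A * Real.logb 2 (2 * m / n)) ∧
        (∀ i : Fin m, Real.sqrt (∑ j, ((A * ((1 : Matrix (Fin n) (Fin n) ℝ) - Vᵀ * V)) i j) ^ 2)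
          ≤ 48 * Real.exp 1 * Real.logb 2 (8 * m / n) * herdisc A) := by
  refine ⟨16, by norm_num, fun m n A hnm => ?_⟩
  rcases Nat.eq_zero_or_pos n with rfl | hn
  · exact ⟨0, 0, le_rfl, Subsingleton.elim _ _, by simp, by simp⟩
  have hA := hasSignings_herdisc A
  have hh : 0 ≤ herdisc A := by
    obtain ⟨x, -, -, hx⟩ := hA ∅
    exact (abs_nonneg _).trans (hx ⟨0, hn.trans_le hnm⟩)
  obtain ⟨ℓ, V, hℓ, hV, hrow⟩ := hA.exists_projection hh
  have hn' : (0 : ℝ) < n := by exact_mod_cast hn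
  have hnm' : (n : ℝ) ≤ m := by exact_mod_cast hnm
  have hlog : ∀ c : ℝ, 2 ≤ c → 1 ≤ Real.logb 2 (c * m / n) := by
    intro c hc
    have h2 : 2 ≤ c * m / n := by
      rw [le_div_iff₀ hn']
      gcongr
    rw [Real.le_logb_iff_rpow_le one_lt_two (by linarith), Real.rpow_one]
    exact h2
  refine ⟨ℓ, V, hℓ, hV, fun i => (hrow i).trans ?_, fun i => (hrow i).trans ?_⟩
  · exact le_mul_of_one_le_right (by positivity) (hlog 2 le_rfl)
  · have hexp : 1 ≤ Real.exp 1 := Real.one_le_exp zero_le_one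
    have hl := hlog 8 (by norm_num)
    have : 16 ≤ 48 * Real.exp 1 * Real.logb 2 (8 * m / n) := by
      nlinarith
    gcongr
end

section
/- There is a universal constant C > 0 such that for every real matrix A ∈ ℝ^{m×n} with m ≥ n and every partial coloring x ∈ (-1,1)^n, there exists a vector x' ∈ [-1,1]^n such that at least n/2 coordinates of x' have absolute value exactly 1, and for every row a_i of A one has |⟨a_i, x'⟩ − ⟨a_i, x⟩| ≤ C · (log₂(2m/n))^{3/2} · herdisc(A). -/
open Matrix

theorem finite_signVectors (J : Type*) [Finite J] :
    {z : J → ℝ | ∀ j, z j = 1 ∨ z j = -1}.Finite := by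
  have h := Set.Finite.pi (ι := J) (t := fun _ => ({1, -1} : Set ℝ))
    (fun _ => Set.toFinite _)
  refine h.subset fun z hz => ?_
  simpa [Set.mem_pi] using hz

/-- The discrepancy is attained by some coloring. -/
theorem exists_coloring_le_disc {I J : Type*} [Fintype I] [Fintype J] (A : Matrix I J ℝ) :
    ∃ x : J → ℝ, (∀ j, x j = 1 ∨ x j = -1) ∧ ∀ i, |A.mulVec x i| ≤ disc A := by
  have hfin : {d : ℝ | ∃ x : J → ℝ, (∀ j, x j = 1 ∨ x j = -1) ∧
      d = ⨆ i, |A.mulVec x i|}.Finite := by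
    refine ((finite_signVectors J).image fun x => ⨆ i, |A.mulVec x i|).subset ?_
    rintro d ⟨x, hx, rfl⟩
    exact ⟨x, hx, rfl⟩
  obtain ⟨x, hx, hd⟩ := Set.Nonempty.csInf_mem
    (by exact ⟨_, fun _ => 1, fun _ => Or.inl rfl, rfl⟩) hfin
  refine ⟨x, hx, fun i => ?_⟩
  unfold disc
  rw [hd]
  exact le_ciSup (f := fun i => |A.mulVec x i|) (Set.finite_range _).bddAbove i

/-- Any set of columns has a coloring, extended by zero, of discrepancy at most `herdisc A`. -/
theorem exists_coloring_on_le_herdisc {m n : ℕ} (A : Matrix (Fin m) (Fin n) ℝ)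
    (S : Finset (Fin n)) :
    ∃ e : Fin n → ℝ, (∀ j ∈ S, e j = 1 ∨ e j = -1) ∧ (∀ j ∉ S, e j = 0) ∧
      ∀ i, |A.mulVec e i| ≤ herdisc A := by
  obtain ⟨y, hy, hyd⟩ := exists_coloring_le_disc
    (A.submatrix id (fun j : {j // j ∈ S} => (j : Fin n)))
  refine ⟨fun j => if h : j ∈ S then y ⟨j, h⟩ else 0, fun j hj => ?_, fun j hj => ?_,
    fun i => ?_⟩
  · simpa [hj] using hy ⟨j, hj⟩
  · simp [hj]
  · refine le_trans (le_of_eq ?_) ((hyd i).trans (disc_submatrix_le_herdisc A S))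
    congr 1
    simp only [Matrix.mulVec, dotProduct, Matrix.submatrix_apply, id]
    rw [← Finset.sum_subset (Finset.subset_univ S) (fun j _ hj => by simp [hj]),
      ← Finset.sum_coe_sort S]
    exact Finset.sum_congr rfl fun j _ => by simp

/-- Rounding all points of the cube with error `M` allows rounding with error
`M / 2 + herdisc A`: round `2 x - sign x`, and color the coordinates of the resulting
half-integral approximation of `x` that vanish. -/
theorem exists_rounding_step {m n : ℕ} (A : Matrix (Fin m) (Fin n) ℝ) (M : ℝ)
    (hM : ∀ x : Fin n → ℝ, (∀ j, |x j| ≤ 1) → ∃ z : Fin n → ℝ,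
      (∀ j, z j = 1 ∨ z j = -1) ∧ ∀ i, |A.mulVec (z - x) i| ≤ M)
    (x : Fin n → ℝ) (hx : ∀ j, |x j| ≤ 1) :
    ∃ z : Fin n → ℝ, (∀ j, z j = 1 ∨ z j = -1) ∧
      ∀ i, |A.mulVec (z - x) i| ≤ M / 2 + herdisc A := by
  let v : Fin n → ℝ := fun j => if 0 ≤ x j then 1 else -1
  have hv : ∀ j, v j = 1 ∨ v j = -1 := fun j => by
    by_cases h : 0 ≤ x j <;> simp [v, h]
  obtain ⟨z, hz, hzM⟩ := hM ((2 : ℝ) • x - v) fun j => by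
    have := abs_le.1 (hx j)
    by_cases h : 0 ≤ x j
    · simp only [Pi.sub_apply, Pi.smul_apply, smul_eq_mul, v, h, if_true]
      exact abs_le.2 ⟨by linarith, by linarith⟩
    · simp only [Pi.sub_apply, Pi.smul_apply, smul_eq_mul, v, h, if_false]
      push Not at h
      exact abs_le.2 ⟨by linarith, by linarith⟩
  obtain ⟨e, he, he0, heA⟩ := exists_coloring_on_le_herdisc A
    (Finset.univ.filter fun j => v j + z j = 0)
  refine ⟨(2⁻¹ : ℝ) • (v + z) + e, fun j => ?_, fun i => ?_⟩
  · simp only [Pi.add_apply, Pi.smul_apply, smul_eq_mul]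
    by_cases h : v j + z j = 0
    · simpa [h] using he j (by simp [h])
    · rw [he0 j (by simp [h])]
      rcases hv j with h1 | h1 <;> rcases hz j with h2 | h2 <;>
        first | (norm_num [h1, h2]; done) | norm_num [h1, h2] at h
  · have heq : (2⁻¹ : ℝ) • (v + z) + e - x = (2⁻¹ : ℝ) • (z - ((2 : ℝ) • x - v)) + e := by
      ext j
      simp only [Pi.add_apply, Pi.sub_apply, Pi.smul_apply, smul_eq_mul]
      ring
    rw [heq, Matrix.mulVec_add, Matrix.mulVec_smul, Pi.add_apply, Pi.smul_apply, smul_eq_mul]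
    refine (abs_add_le _ _).trans (add_le_add ?_ (heA i))
    rw [abs_mul, abs_of_pos (by norm_num : (0 : ℝ) < 2⁻¹)]
    linarith [hzM i]

/-- **Lovász–Spencer–Vesztergombi**: the linear discrepancy is at most twice the hereditary
discrepancy. -/
theorem exists_rounding_le_two_mul_herdisc {m n : ℕ} (A : Matrix (Fin m) (Fin n) ℝ)
    (x : Fin n → ℝ) (hx : ∀ j, |x j| ≤ 1) :
    ∃ z : Fin n → ℝ, (∀ j, z j = 1 ∨ z j = -1) ∧
      ∀ i, |A.mulVec (z - x) i| ≤ 2 * herdisc A := by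
  let K : ℝ := ∑ i, ∑ j, |A i j| * 2
  have hK : 0 ≤ K := by positivity
  have hiter : ∀ k : ℕ, ∀ x : Fin n → ℝ, (∀ j, |x j| ≤ 1) → ∃ z : Fin n → ℝ,
      (∀ j, z j = 1 ∨ z j = -1) ∧
        ∀ i, |A.mulVec (z - x) i| ≤ 2 * herdisc A + K * (1 / 2) ^ k := by
    intro k
    induction k with
    | zero =>
      intro x hx
      refine ⟨fun _ => 1, fun _ => Or.inl rfl, fun i => ?_⟩
      have h1 : |A.mulVec ((fun _ => 1) - x) i| ≤ ∑ j, |A i j| * 2 := by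
        simp only [Matrix.mulVec, dotProduct]
        refine (Finset.abs_sum_le_sum_abs _ _).trans (Finset.sum_le_sum fun j _ => ?_)
        rw [abs_mul]
        refine mul_le_mul_of_nonneg_left ?_ (abs_nonneg _)
        have := abs_le.1 (hx j)
        exact abs_le.2 ⟨by simp only [Pi.sub_apply]; linarith,
          by simp only [Pi.sub_apply]; linarith⟩
      have h2 : ∑ j, |A i j| * 2 ≤ K :=
        Finset.single_le_sum (f := fun i => ∑ j, |A i j| * 2)
          (fun i _ => by positivity) (Finset.mem_univ i)
      have := herdisc_nonneg A
      simp only [pow_zero, mul_one]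
      linarith
    | succ k ih =>
      intro x hx
      obtain ⟨z, hz, hzA⟩ := exists_rounding_step A _ ih x hx
      refine ⟨z, hz, fun i => (hzA i).trans (le_of_eq ?_)⟩
      ring
  obtain ⟨z, hz, hmin⟩ := Set.exists_min_image _ (fun z => ‖A.mulVec (z - x)‖)
    (finite_signVectors (Fin n)) ⟨fun _ => 1, fun _ => Or.inl rfl⟩
  refine ⟨z, hz, fun i => (norm_le_pi_norm (A.mulVec (z - x)) i).trans ?_⟩
  have hlim : Filter.Tendsto (fun k : ℕ => 2 * herdisc A + K * (1 / 2 : ℝ) ^ k) Filter.atTop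
      (nhds (2 * herdisc A + K * 0)) :=
    ((tendsto_pow_atTop_nhds_zero_of_lt_one (by norm_num) (by norm_num)).const_mul K).const_add _
  rw [mul_zero, add_zero] at hlim
  refine ge_of_tendsto' hlim fun k => ?_
  obtain ⟨w, hw, hwA⟩ := hiter k x hx
  refine (hmin w hw).trans ((pi_norm_le_iff_of_nonneg ?_).2 hwA)
  have := herdisc_nonneg A
  positivity

/-- there is a universal `C > 0` such that for every `A ∈ ℝ^{m×n}` with
`m ≥ n` and every partial coloring `x ∈ (-1,1)ⁿ` there is `x' ∈ [-1,1]ⁿ` with at least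
`n/2` coordinates of absolute value exactly `1`, and
`|⟨a_i, x'⟩ - ⟨a_i, x⟩| ≤ C·(log₂(2m/n))^{3/2}·herdisc(A)` for every row `a_i` of `A`. -/
theorem stmt3 : ∃ C : ℝ, C > 0 ∧
    ∀ (m n : ℕ) (A : Matrix (Fin m) (Fin n) ℝ), n ≤ m →
      ∀ x : Fin n → ℝ, (∀ j, |x j| < 1) →
        ∃ x' : Fin n → ℝ, (∀ j, |x' j| ≤ 1) ∧
          n ≤ 2 * (Finset.univ.filter fun j : Fin n => |x' j| = 1).card ∧
          ∀ i : Fin m, |A.mulVec x' i - A.mulVec x i| ≤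
            C * (Real.logb 2 (2 * m / n)) ^ ((3 : ℝ) / 2) * herdisc A := by
  refine ⟨2, two_pos, fun m n A hnm x hx => ?_⟩
  obtain ⟨z, hz, hzA⟩ := exists_rounding_le_two_mul_herdisc A x fun j => (hx j).le
  have hz1 : ∀ j, |z j| = 1 := fun j => by rcases hz j with h | h <;> simp [h]
  refine ⟨z, fun j => (hz1 j).le, ?_, fun i => ?_⟩
  · simp only [hz1, Finset.filter_true, Finset.card_univ, Fintype.card_fin]
    omega
  · rw [← Pi.sub_apply, ← Matrix.mulVec_sub]
    rcases Nat.eq_zero_or_pos n with rfl | hn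
    · simp [Matrix.mulVec, dotProduct]
    · refine (hzA i).trans (mul_le_mul_of_nonneg_right ?_ (herdisc_nonneg A))
      have hn' : (0 : ℝ) < n := by exact_mod_cast hn
      have hnm' : (n : ℝ) ≤ m := by exact_mod_cast hnm
      have h2 : (2 : ℝ) ≤ 2 * m / n := by
        rw [le_div_iff₀ hn']
        linarith
      have hlog : 1 ≤ Real.logb 2 (2 * m / n) := by
        rw [Real.le_logb_iff_rpow_le (by norm_num) (by linarith), Real.rpow_one]
        exact h2
      have := Real.one_le_rpow hlog (by norm_num : (0 : ℝ) ≤ 3 / 2)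
      linarith
end

section
/- For every real matrix A ∈ ℝ^{m×n} with m < n, there exists a vector x ∈ [-1,1]^n such that Ax = 0 and at least n − m coordinates of x have absolute value exactly 1. -/
open Matrix

/-- A small multiple of a direction vanishing on the tight coordinates of a point of the cube
fits into the slack of that point. -/
theorem exists_pos_mul_abs_le_one_sub_abs {ι : Type*} [Finite ι] {x y : ι → ℝ}
    (hx : ∀ j, |x j| ≤ 1) (hy : ∀ j, |x j| = 1 → y j = 0) :
    ∃ ε > 0, ∀ j, ε * |y j| ≤ 1 - |x j| := by
  have h : ∀ᶠ ε in nhdsWithin (0 : ℝ) (Set.Ioi 0), ∀ j, ε * |y j| ≤ 1 - |x j| := by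
    refine Filter.eventually_all.2 fun j => ?_
    rcases (hx j).eq_or_lt with hj | hj
    · simp [hy j hj, hj]
    · have hc : Filter.Tendsto (fun ε : ℝ => ε * |y j|) (nhds 0) (nhds 0) := by
        simpa using (continuous_mul_const |y j|).tendsto 0
      exact ((hc.eventually_lt_const (sub_pos.2 hj)).filter_mono nhdsWithin_le_nhds).mono
        fun _ h => h.le
  obtain ⟨ε, hε, hpos⟩ := (h.and self_mem_nhdsWithin).exists
  exact ⟨ε, hpos, hε⟩

/-- The kernel of a matrix contains a nonzero vector vanishing on a given set of coordinates,
if the number of rows plus the number of these coordinates is less than the number of columns. -/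
theorem Matrix.exists_mulVec_eq_zero_of_vanishing {K ι κ : Type*} [Field K] [Fintype ι] [Fintype κ]
    (A : Matrix κ ι K) (T : Finset ι) (h : Fintype.card κ + T.card < Fintype.card ι) :
    ∃ y : ι → K, y ≠ 0 ∧ A *ᵥ y = 0 ∧ ∀ j ∈ T, y j = 0 := by
  let f : (ι → K) →ₗ[K] (κ → K) × (T → K) :=
    A.mulVecLin.prod (LinearMap.funLeft K K Subtype.val)
  have hf : LinearMap.ker f ≠ ⊥ := LinearMap.ker_ne_bot_of_finrank_lt (by simpa using h)
  obtain ⟨y, hy, hy0⟩ := (Submodule.ne_bot_iff _).1 hf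
  obtain ⟨hA, hT⟩ := Prod.ext_iff.1 (LinearMap.mem_ker.1 hy)
  exact ⟨y, hy0, hA, fun j hj => congrFun hT ⟨j, hj⟩⟩

theorem Matrix.isCompact_cube_inter_ker {ι κ : Type*} [Fintype ι] (A : Matrix κ ι ℝ) :
    IsCompact {x : ι → ℝ | (∀ j, |x j| ≤ 1) ∧ A *ᵥ x = 0} := by
  have hcube : IsCompact {x : ι → ℝ | ∀ j, |x j| ≤ 1} := by
    simpa [Set.pi, abs_le] using isCompact_univ_pi fun _ : ι => isCompact_Icc (a := (-1 : ℝ)) (b := 1)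
  exact hcube.inter_right (isClosed_eq (by fun_prop) continuous_const)

/-- for every `A ∈ ℝ^{m×n}` with `m < n` there is `x ∈ [-1,1]ⁿ` with
`Ax = 0` and at least `n - m` coordinates of absolute value exactly `1`. -/
theorem stmt6 (m n : ℕ) (hmn : m < n) (A : Matrix (Fin m) (Fin n) ℝ) :
    ∃ x : Fin n → ℝ, (∀ j, |x j| ≤ 1) ∧ A.mulVec x = 0 ∧
      n - m ≤ (Finset.univ.filter fun j : Fin n => |x j| = 1).card := by
  obtain ⟨x, hx⟩ := A.isCompact_cube_inter_ker.extremePoints_nonempty ⟨0, by simp⟩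
  obtain ⟨⟨hx1, hAx⟩, hext⟩ := mem_extremePoints.1 hx
  refine ⟨x, hx1, hAx, ?_⟩
  by_contra! hcard
  obtain ⟨y, hy0, hAy, hy⟩ := A.exists_mulVec_eq_zero_of_vanishing
    (Finset.univ.filter fun j : Fin n => |x j| = 1) (by simp only [Fintype.card_fin]; omega)
  obtain ⟨ε, hε, hle⟩ := exists_pos_mul_abs_le_one_sub_abs hx1 fun j hj => hy j (by simpa using hj)
  have hmem : ∀ c : ℝ, |c| = ε →
      x + c • y ∈ {x : Fin n → ℝ | (∀ j, |x j| ≤ 1) ∧ A *ᵥ x = 0} := by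
    refine fun c hc => ⟨fun j => ?_, by simp [mulVec_add, mulVec_smul, hAx, hAy]⟩
    have hadd := abs_add_le (x j) (c * y j)
    rw [abs_mul, hc] at hadd
    simpa using hadd.trans (by linarith [hle j])
  have hseg : x ∈ openSegment ℝ (x + ε • y) (x + (-ε) • y) :=
    ⟨1 / 2, 1 / 2, by norm_num, by norm_num, by norm_num, by module⟩
  have heq := (hext _ (hmem ε (abs_of_pos hε)) _ (hmem (-ε) (by simp [abs_of_pos hε])) hseg).1
  simp [hε.ne', hy0] at heq
end

section
/- Let B ∈ ℝ^{k×n} be a real matrix, let μ_1 ≥ μ_2 ≥ ⋯ ≥ μ_n ≥ 0 be the eigenvalues of BᵀB with corresponding orthonormal eigenvectors η_1, …, η_n, and for 1 ≤ j < n let W ∈ ℝ^{j×n} be the matrix whose rows are η_1, …, η_j. Then for every τ > 0, the number of rows of B(I − WᵀW) whose Euclidean norm exceeds τ is at most (n − j)·μ_{j+1}/τ². -/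
open Matrix

/-- The squares of the entries of a row have the same sum in every orthonormal basis. -/
theorem sum_mulVec_sq_eq_sum_sq {m ι : Type*} [Fintype ι] [DecidableEq ι]
    (M : Matrix m ι ℝ) (E : Matrix ι ι ℝ) (hE : E * Eᵀ = 1) (r : m) :
    ∑ i, ((M *ᵥ E i) r) ^ 2 = ∑ c, (M r c) ^ 2 := by
  have h : (M * Eᵀ) * (M * Eᵀ)ᵀ = M * Mᵀ := by
    rw [transpose_mul, transpose_transpose, Matrix.mul_assoc, ← Matrix.mul_assoc Eᵀ,
      mul_eq_one_comm.mp hE, Matrix.one_mul]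
  have hdiag := congrFun (congrFun h r) r
  simpa [mul_apply, mulVec, dotProduct, sq, mul_comm] using hdiag

/-- Removing an initial segment of an orthonormal family annihilates its vectors and fixes the
others. -/
theorem one_sub_transpose_mul_self_mulVec {n j : ℕ} (hj : j ≤ n) (η : Fin n → Fin n → ℝ)
    (hη : ∀ i l : Fin n, (∑ t, η i t * η l t) = if i = l then 1 else 0)
    (W : Matrix (Fin j) (Fin n) ℝ) (hW : ∀ r, W r = η (Fin.castLE hj r)) (i : Fin n) :
    (1 - Wᵀ * W) *ᵥ η i = if (i : ℕ) < j then 0 else η i := by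
  have hWη : ∀ r, (W *ᵥ η i) r = if Fin.castLE hj r = i then 1 else 0 := fun r => by
    rw [← hη, ← hW]; rfl
  rw [sub_mulVec, one_mulVec, ← mulVec_mulVec]
  split_ifs with h
  · have h1 : W *ᵥ η i = Pi.single ⟨i, h⟩ 1 := by
      ext r
      simp [hWη, Pi.single_apply, Fin.ext_iff]
    have h2 : W ⟨i, h⟩ = η i := hW _
    rw [h1, mulVec_single_one, sub_eq_zero, ← h2]
    rfl
  · have h1 : W *ᵥ η i = 0 := by
      ext r
      have : Fin.castLE hj r ≠ i := fun e => h (e ▸ r.isLt)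
      simp [hWη, this]
    rw [h1, mulVec_zero, sub_zero]

/-- The image of a unit eigenvector of `BᵀB` has squared norm the eigenvalue. -/
theorem sum_mulVec_sq_eq_eigenvalue {m ι : Type*} [Fintype m] [Fintype ι] (B : Matrix m ι ℝ)
    (v : ι → ℝ) (μ : ℝ) (hv : v ⬝ᵥ v = 1) (h : (Bᵀ * B) *ᵥ v = μ • v) :
    ∑ r, ((B *ᵥ v) r) ^ 2 = μ := by
  calc ∑ r, ((B *ᵥ v) r) ^ 2 = (B *ᵥ v) ⬝ᵥ (B *ᵥ v) := by simp [dotProduct, sq]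
    _ = v ⬝ᵥ ((Bᵀ * B) *ᵥ v) := by
      rw [← mulVec_mulVec, dotProduct_mulVec v, vecMul_transpose]
    _ = μ := by rw [h, dotProduct_smul, hv, smul_eq_mul, mul_one]

/-- Chebyshev's counting bound for square roots. -/
theorem card_lt_sqrt_mul_sq_le_sum {m : Type*} [Fintype m] (f : m → ℝ) (hf : ∀ r, 0 ≤ f r)
    {τ : ℝ} (hτ : 0 < τ) :
    ((Finset.univ.filter fun r => τ < Real.sqrt (f r)).card : ℝ) * τ ^ 2 ≤ ∑ r, f r := by
  rw [← nsmul_eq_mul]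
  refine (Finset.card_nsmul_le_sum _ f _ fun r hr => ?_).trans
    (Finset.sum_le_univ_sum_of_nonneg hf)
  exact ((Real.lt_sqrt hτ.le).mp (Finset.mem_filter.mp hr).2).le

/-- let `μ_1 ≥ ⋯ ≥ μ_n ≥ 0` be the eigenvalues of `BᵀB` with orthonormal
eigenvectors `η_1,…,η_n`, and let `W` have rows `η_1,…,η_j` (`1 ≤ j < n`). Then for
every `τ > 0`, the number of rows of `B(I - WᵀW)` of Euclidean norm exceeding `τ` is
at most `(n - j)·μ_{j+1}/τ²`. -/
theorem stmt8 (k n : ℕ) (B : Matrix (Fin k) (Fin n) ℝ)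
    (mu : Fin n → ℝ) (η : Fin n → Fin n → ℝ)
    (hanti : ∀ i j : Fin n, i ≤ j → mu j ≤ mu i)
    (hnonneg : ∀ i, 0 ≤ mu i)
    (hortho : ∀ i j : Fin n, (∑ t, η i t * η j t) = if i = j then 1 else 0)
    (heig : ∀ i, (Bᵀ * B).mulVec (η i) = mu i • η i)
    (j : ℕ) (hj1 : 1 ≤ j) (hjn : j < n)
    (W : Matrix (Fin j) (Fin n) ℝ) (hW : ∀ r : Fin j, W r = η (Fin.castLE hjn.le r))
    (τ : ℝ) (hτ : 0 < τ) :
    ((Finset.univ.filter fun i : Fin k =>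
        τ < Real.sqrt
          (∑ c, ((B * ((1 : Matrix (Fin n) (Fin n) ℝ) - Wᵀ * W)) i c) ^ 2)).card : ℝ)
      ≤ ((n : ℝ) - j) * mu ⟨j, hjn⟩ / τ ^ 2 := by
  rw [le_div_iff₀ (by positivity)]
  refine (card_lt_sqrt_mul_sq_le_sum _ (fun r => by positivity) hτ).trans ?_
  have hE : (Matrix.of η) * (Matrix.of η)ᵀ = 1 := by
    ext a b
    simpa [mul_apply, one_apply] using hortho a b
  set M := B * ((1 : Matrix (Fin n) (Fin n) ℝ) - Wᵀ * W) with hM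
  have hcol : ∀ i, ∑ r, ((M *ᵥ η i) r) ^ 2 = if (i : ℕ) < j then 0 else mu i := by
    intro i
    rw [hM, ← mulVec_mulVec, one_sub_transpose_mul_self_mulVec hjn.le η hortho W hW]
    split_ifs
    · simp
    · exact sum_mulVec_sq_eq_eigenvalue B _ _ (by simpa [dotProduct] using hortho i i) (heig i)
  calc ∑ r, ∑ c, (M r c) ^ 2
      = ∑ r, ∑ i, ((M *ᵥ η i) r) ^ 2 :=
        Finset.sum_congr rfl fun r _ => (sum_mulVec_sq_eq_sum_sq M (Matrix.of η) hE r).symm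
    _ = ∑ i : Fin n, if (i : ℕ) < j then 0 else mu i := by
        rw [Finset.sum_comm]
        exact Finset.sum_congr rfl fun i _ => hcol i
    _ ≤ ∑ i : Fin n, if (i : ℕ) < j then 0 else mu ⟨j, hjn⟩ := by
        refine Finset.sum_le_sum fun i _ => ?_
        split_ifs with h
        · exact le_rfl
        · exact hanti _ _ (not_lt.mp h)
    _ = ((n : ℝ) - j) * mu ⟨j, hjn⟩ := by
        rw [Fin.sum_univ_eq_sum_range (fun i => if i < j then 0 else mu ⟨j, hjn⟩),
          ← Finset.sum_range_add_sum_Ico _ hjn.le,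
          Finset.sum_eq_zero fun i hi => if_pos (Finset.mem_range.mp hi),
          Finset.sum_congr rfl fun i hi => if_neg (Finset.mem_Ico.mp hi).1.not_gt]
        simp [Nat.cast_sub hjn.le]
end

section
/- There is a universal constant c > 0 such that the following holds for every real matrix A ∈ ℝ^{m×n} with m ≥ n ≥ 2. Let λ_1 ≥ ⋯ ≥ λ_n ≥ 0 be the eigenvalues of AᵀA with corresponding orthonormal eigenvectors, and let V ∈ ℝ^{⌊n/2⌋×n} be the matrix whose rows are the eigenvectors corresponding to the ⌊n/2⌋ largest eigenvalues. Then at most m/2 rows of A(I − VᵀV) have Euclidean norm exceeding c·herdisc(A). -/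
open Matrix

lemma exists_signing_abs_le_herdisc {m n : ℕ} (A : Matrix (Fin m) (Fin n) ℝ)
    (S : Finset (Fin n)) :
    ∃ x : Fin n → ℝ, (∀ j, x j = 1 ∨ x j = -1) ∧
      ∀ i, |∑ j ∈ S, A i j * x j| ≤ herdisc A := by
  set B := A.submatrix id (fun j : {j // j ∈ S} => (j : Fin n)) with hB
  set T := {d : ℝ | ∃ x : {j // j ∈ S} → ℝ, (∀ j, x j = 1 ∨ x j = -1) ∧
    d = ⨆ i, |B.mulVec x i|} with hT
  have hfin : T.Finite := by
    have h1 : (Set.univ.pi fun _ : {j // j ∈ S} => ({1, -1} : Set ℝ)).Finite :=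
      Set.Finite.pi fun _ => Set.toFinite _
    refine (h1.image fun x => ⨆ i, |B.mulVec x i|).subset ?_
    rintro d ⟨x, hx, rfl⟩
    exact ⟨x, fun j _ => by simpa using hx j, rfl⟩
  have hne : T.Nonempty := ⟨_, fun _ => 1, fun _ => Or.inl rfl, rfl⟩
  obtain ⟨x, hx, hd⟩ : disc B ∈ T := hne.csInf_mem hfin
  have hle : disc B ≤ herdisc A := by
    refine le_csSup (Set.Finite.bddAbove ?_) ⟨S, rfl⟩
    refine (Set.finite_range fun S : Finset (Fin n) =>
      disc (A.submatrix id (fun j : {j // j ∈ S} => (j : Fin n)))).subset ?_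
    rintro d ⟨S', rfl⟩
    exact ⟨S', rfl⟩
  refine ⟨fun j => if h : j ∈ S then x ⟨j, h⟩ else 1, fun j => ?_, fun i => ?_⟩
  · by_cases h : j ∈ S
    · simpa [h] using hx ⟨j, h⟩
    · simp [h]
  · have h1 : ∑ j ∈ S, A i j * (if h : j ∈ S then x ⟨j, h⟩ else 1) = B.mulVec x i := by
      rw [← Finset.sum_coe_sort S]
      simp [Matrix.mulVec, dotProduct, hB]
    rw [h1]
    exact ((le_ciSup (f := fun i => |B.mulVec x i|) (Set.finite_range _).bddAbove i).trans
      hd.ge).trans hle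

lemma exists_round_dyadic {m n : ℕ} (A : Matrix (Fin m) (Fin n) ℝ) (p : ℕ) :
    ∀ a : Fin n → ℕ, (∀ j, a j ≤ 2 ^ p) → ∃ z : Fin n → Bool,
      ∀ i, |∑ j, A i j * ((a j : ℝ) / 2 ^ p - (if z j then 1 else 0))|
        ≤ herdisc A * (1 - 1 / 2 ^ p) := by
  induction p with
  | zero =>
    intro a ha
    refine ⟨fun j => decide (a j = 1), fun i => ?_⟩
    have h0 : ∀ j, A i j * ((a j : ℝ) / 2 ^ 0 - (if decide (a j = 1) then 1 else 0)) = 0 := by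
      intro j
      have : a j = 0 ∨ a j = 1 := by have := ha j; simp at this; omega
      rcases this with h | h <;> simp [h]
    rw [Finset.sum_eq_zero fun j _ => h0 j]
    simp
  | succ p ih =>
    intro a ha
    obtain ⟨x, hx, hxA⟩ := exists_signing_abs_le_herdisc A {j | a j % 2 = 1}
    obtain ⟨z, hz⟩ := ih (fun j => if a j % 2 = 1 ∧ x j = 1 then a j / 2 + 1 else a j / 2) (by
      intro j
      have := ha j
      rw [pow_succ] at this
      split_ifs <;> omega)
    refine ⟨z, fun i => ?_⟩
    have key : ∑ j, A i j * ((a j : ℝ) / 2 ^ (p + 1) - (if z j then 1 else 0)) =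
        ∑ j, A i j * (((if a j % 2 = 1 ∧ x j = 1 then a j / 2 + 1 else a j / 2 : ℕ) : ℝ) / 2 ^ p
          - (if z j then 1 else 0))
        - (1 / 2 ^ (p + 1)) * ∑ j with a j % 2 = 1, A i j * x j := by
      rw [Finset.sum_filter, Finset.mul_sum, ← Finset.sum_sub_distrib]
      refine Finset.sum_congr rfl fun j _ => ?_
      have hdm : (a j : ℝ) = 2 * ((a j / 2 : ℕ) : ℝ) + ((a j % 2 : ℕ) : ℝ) := by
        exact_mod_cast (Nat.div_add_mod (a j) 2).symm
      rw [pow_succ]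
      rcases Nat.mod_two_eq_zero_or_one (a j) with h | h
      · rw [hdm]
        simp only [h]
        simp
        left
        field_simp
      · rw [hdm]
        rcases hx j with h' | h'
        · simp only [h, h']
          simp
          field_simp
          ring
        · have : ¬ ((-1 : ℝ) = 1) := by norm_num
          simp only [h, h', this]
          simp
          field_simp
          ring
    rw [key]
    refine (abs_sub _ _).trans ?_
    rw [abs_mul, abs_of_nonneg (by positivity : (0 : ℝ) ≤ 1 / 2 ^ (p + 1))]
    have h1 := mul_le_mul_of_nonneg_left (hxA i) (by positivity : (0 : ℝ) ≤ 1 / 2 ^ (p + 1))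
    have h2 := hz i
    have h3 : (1 : ℝ) / 2 ^ p = 2 * (1 / 2 ^ (p + 1)) := by rw [pow_succ]; field_simp
    rw [h3] at h2
    nlinarith [h1, h2]

lemma exists_round_of_herdisc_lt {m n : ℕ} [NeZero m] (A : Matrix (Fin m) (Fin n) ℝ) {D : ℝ}
    (hD : herdisc A < D) {y : Fin n → ℝ} (hy0 : ∀ j, 0 ≤ y j) (hy1 : ∀ j, y j ≤ 1) :
    ∃ z : Fin n → Bool, ∀ i, |A.mulVec (fun j => y j - (if z j then 1 else 0)) i| ≤ D := by
  set M : ℝ := ∑ i, ∑ j, |A i j| with hM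
  have hH : 0 ≤ herdisc A := by
    obtain ⟨x, -, h⟩ := exists_signing_abs_le_herdisc A ∅
    simpa using h 0
  obtain ⟨p, hp⟩ := pow_unbounded_of_one_lt (M / (D - herdisc A)) (one_lt_two (α := ℝ))
  have hp0 : (0 : ℝ) < 2 ^ p := by positivity
  obtain ⟨z, hz⟩ := exists_round_dyadic A p (fun j => ⌊y j * 2 ^ p⌋₊) (by
    intro j
    refine Nat.floor_le_of_le ?_
    push_cast
    nlinarith [hy1 j])
  refine ⟨z, fun i => ?_⟩
  have hsplit : A.mulVec (fun j => y j - (if z j then 1 else 0)) i =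
      ∑ j, A i j * (y j - (⌊y j * 2 ^ p⌋₊ : ℝ) / 2 ^ p) +
      ∑ j, A i j * ((⌊y j * 2 ^ p⌋₊ : ℝ) / 2 ^ p - (if z j then 1 else 0)) := by
    rw [← Finset.sum_add_distrib, Matrix.mulVec, dotProduct]
    exact Finset.sum_congr rfl fun j _ => by ring
  have herr : |∑ j, A i j * (y j - (⌊y j * 2 ^ p⌋₊ : ℝ) / 2 ^ p)| ≤ M / 2 ^ p := by
    calc _ ≤ ∑ j, |A i j| * (1 / 2 ^ p) := by
          refine (Finset.abs_sum_le_sum_abs _ _).trans (Finset.sum_le_sum fun j _ => ?_)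
          rw [abs_mul]
          refine mul_le_mul_of_nonneg_left ?_ (abs_nonneg _)
          have h1 := Nat.floor_le (mul_nonneg (hy0 j) hp0.le)
          have h2 := Nat.lt_floor_add_one (y j * 2 ^ p)
          rw [abs_le]
          constructor
          · have : (⌊y j * 2 ^ p⌋₊ : ℝ) / 2 ^ p ≤ y j := by rwa [div_le_iff₀ hp0]
            have : (0 : ℝ) ≤ 1 / 2 ^ p := by positivity
            linarith
          · rw [sub_le_iff_le_add, ← add_div, le_div_iff₀ hp0]
            linarith
      _ = (∑ j, |A i j|) / 2 ^ p := by rw [← Finset.sum_mul]; ring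
      _ ≤ M / 2 ^ p := by
          gcongr
          exact Finset.single_le_sum (f := fun i => ∑ j, |A i j|)
            (fun _ _ => Finset.sum_nonneg fun _ _ => abs_nonneg _) (Finset.mem_univ i)
  have hsmall : M / 2 ^ p ≤ D - herdisc A := by
    rw [div_lt_iff₀ (sub_pos.2 hD)] at hp
    rw [div_le_iff₀ hp0]
    linarith
  have hzi : herdisc A * (1 - 1 / 2 ^ p) ≤ herdisc A :=
    mul_le_of_le_one_right hH (by have : (0 : ℝ) ≤ 1 / 2 ^ p := by positivity
                                  linarith)
  rw [hsplit]
  refine (abs_add_le _ _).trans ?_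
  linarith [hz i]

open MeasureTheory in
lemma measurePreserving_mulVec_of_orthogonal {n : ℕ} {H : Matrix (Fin n) (Fin n) ℝ}
    (hH : H * Hᵀ = 1) : MeasurePreserving (fun u : Fin n → ℝ => H.mulVec u) volume volume := by
  have hdet : H.det * H.det = 1 := by
    simpa [Matrix.det_mul, Matrix.det_transpose] using congrArg Matrix.det hH
  have hne : H.det ≠ 0 := by rintro h; simp [h] at hdet
  have habs : |H.det⁻¹| = 1 := by
    rcases mul_self_eq_one_iff.1 hdet with h | h <;> simp [h]
  refine ⟨(Continuous.matrix_mulVec continuous_const continuous_id).measurable, ?_⟩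
  have := Real.map_matrix_volume_pi_eq_smul_volume_pi hne
  rw [habs, ENNReal.ofReal_one, one_smul] at this
  exact this

open MeasureTheory in
lemma integrable_exp_neg_sum_sq {n : ℕ} {b : Fin n → ℝ} (hb : ∀ i, 0 < b i) :
    Integrable (fun w : Fin n → ℝ => Real.exp (-∑ i, b i * w i ^ 2)) := by
  have h := Integrable.fintype_prod (μ := fun _ : Fin n => (volume : Measure ℝ))
    (fun i => integrable_exp_neg_mul_sq (hb i))
  refine h.congr (Filter.Eventually.of_forall fun w => ?_)
  simp [← Real.exp_sum, Finset.sum_neg_distrib]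

open MeasureTheory in
lemma integral_exp_neg_sum_sq {n : ℕ} (b : Fin n → ℝ) :
    ∫ w : Fin n → ℝ, Real.exp (-∑ i, b i * w i ^ 2) = ∏ i, √(Real.pi / b i) := by
  simp_rw [← integral_gaussian]
  rw [← integral_fintype_prod_volume_eq_prod]
  simp [← Real.exp_sum, Finset.sum_neg_distrib]

open MeasureTheory in
/-- If every point of the unit cube is within `∑ bᵢ (H u)ᵢ² ≤ n` of some vertex (with `H`
orthogonal), then the Gaussian integral of this quadratic form is at least `(2e)⁻ⁿ`. -/
lemma one_le_prod_of_cube_cover {n : ℕ} {H : Matrix (Fin n) (Fin n) ℝ} (hH : H * Hᵀ = 1)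
    {b : Fin n → ℝ} (hb : ∀ i, 0 < b i)
    (hcov : ∀ y : Fin n → ℝ, (∀ j, 0 ≤ y j) → (∀ j, y j ≤ 1) → ∃ z : Fin n → Bool,
      ∑ i, b i * (H.mulVec (fun j => y j - (if z j then 1 else 0)) i) ^ 2 ≤ n) :
    1 ≤ (2 * Real.exp 1) ^ n * ∏ i, √(Real.pi / b i) := by
  set g : (Fin n → ℝ) → ℝ := fun u => Real.exp (-∑ i, b i * (H.mulVec u i) ^ 2) with hg
  set Z : (Fin n → Bool) → Fin n → ℝ := fun z j => if z j then 1 else 0 with hZ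
  have hmp := measurePreserving_mulVec_of_orthogonal hH
  have hemb : MeasurableEmbedding (fun u : Fin n → ℝ => H.mulVec u) := by
    refine Continuous.measurableEmbedding
      (Continuous.matrix_mulVec continuous_const continuous_id) fun u v huv => ?_
    have := congrArg Hᵀ.mulVec huv
    simpa [Matrix.mulVec_mulVec, mul_eq_one_comm.1 hH] using this
  have hgi : Integrable g :=
    (hmp.integrable_comp_emb hemb).2 (integrable_exp_neg_sum_sq hb)
  have hgv : ∫ u, g u = ∏ i, √(Real.pi / b i) := by
    rw [← integral_exp_neg_sum_sq]
    exact hmp.integral_comp hemb (fun w : Fin n → ℝ => Real.exp (-∑ i, b i * w i ^ 2))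
  have hsi : Integrable fun y => ∑ z, g (y - Z z) :=
    integrable_finsetSum _ fun z _ => hgi.comp_sub_right (Z z)
  have hvol : volume.real (Set.Icc (0 : Fin n → ℝ) 1) = 1 := by
    simp [Measure.real, Real.volume_Icc_pi]
  have hlow : Real.exp (-n) ≤ ∫ y, ∑ z, g (y - Z z) := by
    calc Real.exp (-n) = ∫ _ in Set.Icc (0 : Fin n → ℝ) 1, Real.exp (-n) := by
          rw [setIntegral_const, hvol, one_smul]
      _ ≤ ∫ y in Set.Icc (0 : Fin n → ℝ) 1, ∑ z, g (y - Z z) := by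
          refine setIntegral_mono_on ?_ hsi.integrableOn measurableSet_Icc fun y hy => ?_
          · exact integrableOn_const (by simp [Real.volume_Icc_pi])
          · obtain ⟨z, hz⟩ := hcov y hy.1 hy.2
            refine le_trans ?_ (Finset.single_le_sum (f := fun z => g (y - Z z))
              (fun _ _ => (Real.exp_pos _).le) (Finset.mem_univ z))
            exact Real.exp_le_exp.2 (neg_le_neg hz)
      _ ≤ ∫ y, ∑ z, g (y - Z z) :=
          setIntegral_le_integral hsi (Filter.Eventually.of_forall fun y =>
            Finset.sum_nonneg fun _ _ => (Real.exp_pos _).le)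
  rw [integral_finsetSum _ fun z _ => hgi.comp_sub_right (Z z)] at hlow
  simp_rw [integral_sub_right_eq_self g, hgv] at hlow
  simp only [Finset.sum_const, Finset.card_univ, Fintype.card_fun, Fintype.card_bool,
    Fintype.card_fin, nsmul_eq_mul] at hlow
  push_cast at hlow
  have hexp : Real.exp 1 ^ n * Real.exp (-n) = 1 := by
    rw [← Real.exp_nat_mul, ← Real.exp_add]; simp
  calc (1 : ℝ) = Real.exp 1 ^ n * Real.exp (-n) := hexp.symm
    _ ≤ Real.exp 1 ^ n * (2 ^ n * ∏ i, √(Real.pi / b i)) := by gcongr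
    _ = _ := by rw [mul_pow]; ring

lemma diagonal_of_eigenvectors {n : ℕ} {M : Matrix (Fin n) (Fin n) ℝ} {lam : Fin n → ℝ}
    {H : Matrix (Fin n) (Fin n) ℝ} (hH : H * Hᵀ = 1)
    (heig : ∀ i, M.mulVec (H i) = lam i • H i) (u : Fin n → ℝ) :
    u ⬝ᵥ M.mulVec u = ∑ i, lam i * (H.mulVec u i) ^ 2 := by
  have hMH : M * Hᵀ = Hᵀ * Matrix.diagonal lam := by
    ext i j
    have := congrFun (heig j) i
    simpa [Matrix.mulVec, dotProduct, Matrix.mul_apply, Matrix.diagonal_apply, mul_comm] using this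
  have hM : M = Hᵀ * Matrix.diagonal lam * H := by
    rw [← hMH, Matrix.mul_assoc, mul_eq_one_comm.1 hH, Matrix.mul_one]
  rw [hM, ← Matrix.mulVec_mulVec, ← Matrix.mulVec_mulVec, Matrix.dotProduct_mulVec,
    Matrix.vecMul_transpose]
  simp only [dotProduct, Matrix.mulVec_diagonal]
  exact Finset.sum_congr rfl fun i _ => by ring

lemma sum_sq_mulVec_of_orthogonal {n : ℕ} {H : Matrix (Fin n) (Fin n) ℝ} (hH : H * Hᵀ = 1)
    (u : Fin n → ℝ) : ∑ i, (H.mulVec u i) ^ 2 = ∑ i, u i ^ 2 := by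
  have h : H.mulVec u ⬝ᵥ H.mulVec u = u ⬝ᵥ u := by
    rw [Matrix.dotProduct_mulVec, ← Matrix.mulVec_transpose, Matrix.mulVec_mulVec,
      mul_eq_one_comm.1 hH, Matrix.one_mulVec]
  simpa [dotProduct, sq] using h

lemma sum_sq_mulVec_eq {m n : ℕ} (A : Matrix (Fin m) (Fin n) ℝ) (u : Fin n → ℝ) :
    ∑ i, (A.mulVec u i) ^ 2 = u ⬝ᵥ (Aᵀ * A).mulVec u := by
  rw [← Matrix.mulVec_mulVec, Matrix.dotProduct_mulVec, Matrix.vecMul_transpose]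
  simp [dotProduct, sq]

lemma prod_one_add_eigenvalues_le {m n : ℕ} [NeZero m] {A : Matrix (Fin m) (Fin n) ℝ}
    {lam : Fin n → ℝ} {H : Matrix (Fin n) (Fin n) ℝ} (hH : H * Hᵀ = 1)
    (hlam : ∀ i, 0 ≤ lam i) (heig : ∀ i, (Aᵀ * A).mulVec (H i) = lam i • H i)
    {D t : ℝ} (hD : herdisc A < D) (ht : 0 ≤ t) (htD : t * (m * D ^ 2) ≤ n) :
    ∏ i, (1 + t * lam i) ≤ (8 * Real.pi * Real.exp 1 ^ 2) ^ n := by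
  have hq : ∀ i, 0 < 1 + t * lam i := fun i => by have := mul_nonneg ht (hlam i); linarith
  have hpi := Real.pi_pos
  have hcov := one_le_prod_of_cube_cover hH (b := fun i => (1 + t * lam i) / 2)
    (fun i => half_pos (hq i)) fun y hy0 hy1 => by
      obtain ⟨z, hz⟩ := exists_round_of_herdisc_lt A hD hy0 hy1
      refine ⟨z, ?_⟩
      set u : Fin n → ℝ := fun j => y j - (if z j then 1 else 0) with hu
      have h1 : ∑ j, u j ^ 2 ≤ n := by
        calc ∑ j, u j ^ 2 ≤ ∑ j : Fin n, (1 : ℝ) := by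
              refine Finset.sum_le_sum fun j _ => ?_
              rw [sq_le_one_iff_abs_le_one, abs_le]
              have := hy0 j
              have := hy1 j
              simp only [hu]
              split_ifs <;> constructor <;> linarith
          _ = n := by simp
      have h2 : ∑ i, (A.mulVec u i) ^ 2 ≤ m * D ^ 2 := by
        calc ∑ i, (A.mulVec u i) ^ 2 ≤ ∑ i : Fin m, D ^ 2 :=
              Finset.sum_le_sum fun i _ => sq_le_sq' (abs_le.1 (hz i)).1 (abs_le.1 (hz i)).2
          _ = m * D ^ 2 := by simp
      rw [sum_sq_mulVec_eq, diagonal_of_eigenvectors hH heig] at h2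
      rw [← sum_sq_mulVec_of_orthogonal hH] at h1
      have h3 := mul_le_mul_of_nonneg_left h2 ht
      have h4 : ∑ i, (1 + t * lam i) / 2 * (H.mulVec u i) ^ 2 =
          (∑ i, (H.mulVec u i) ^ 2 + t * ∑ i, lam i * (H.mulVec u i) ^ 2) / 2 := by
        rw [Finset.mul_sum, ← Finset.sum_add_distrib, Finset.sum_div]
        exact Finset.sum_congr rfl fun i _ => by ring
      rw [h4]
      linarith
  have hprod : 0 < ∏ i, (1 + t * lam i) := Finset.prod_pos fun i _ => hq i
  have hsq : (∏ i, √(Real.pi / ((1 + t * lam i) / 2))) ^ 2 =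
      (2 * Real.pi) ^ n / ∏ i, (1 + t * lam i) := by
    have : (2 * Real.pi) ^ n = ∏ _i : Fin n, 2 * Real.pi := by simp
    rw [← Finset.prod_pow, this, ← Finset.prod_div_distrib]
    refine Finset.prod_congr rfl fun i _ => ?_
    rw [Real.sq_sqrt (div_nonneg hpi.le (half_pos (hq i)).le)]
    have := (hq i).ne'
    field_simp
  have h1 := one_le_pow₀ (n := 2) hcov
  rw [mul_pow, hsq, ← pow_mul, mul_comm n 2, pow_mul, mul_div_assoc', le_div_iff₀ hprod, one_mul,
    ← mul_pow] at h1
  refine h1.trans_eq ?_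
  ring

lemma mul_eigenvalue_le {m n : ℕ} [NeZero m] {A : Matrix (Fin m) (Fin n) ℝ} (hn : 2 ≤ n)
    {lam : Fin n → ℝ} {H : Matrix (Fin n) (Fin n) ℝ} (hH : H * Hᵀ = 1)
    (hlam : ∀ i, 0 ≤ lam i) (heig : ∀ i, (Aᵀ * A).mulVec (H i) = lam i • H i)
    (hherdisc : 0 ≤ herdisc A) {l : ℝ} (hl0 : 0 ≤ l)
    (hl : ∀ i : Fin n, (i : ℕ) < n / 2 → l ≤ lam i) :
    n * l ≤ (8 * Real.pi * Real.exp 1 ^ 2) ^ 3 * m * herdisc A ^ 2 := by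
  set K : ℝ := 8 * Real.pi * Real.exp 1 ^ 2 with hK
  have hK1 : 1 ≤ K := by
    have h1 : 1 ≤ Real.exp 1 ^ 2 := one_le_pow₀ (Real.one_le_exp zero_le_one)
    have h2 := Real.pi_gt_three
    nlinarith
  have hm : (0 : ℝ) < m := by exact_mod_cast Nat.pos_of_ne_zero (NeZero.ne m)
  have hn0 : (0 : ℝ) < n := by exact_mod_cast (by omega : 0 < n)
  have key : ∀ D, herdisc A < D → n * l ≤ K ^ 3 * m * D ^ 2 := by
    intro D hD
    have hD0 : 0 < D := hherdisc.trans_lt hD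
    set t : ℝ := n / (m * D ^ 2) with ht
    have ht0 : 0 ≤ t := by positivity
    have hle := prod_one_add_eigenvalues_le hH hlam heig hD ht0 (by rw [ht]; field_simp; rfl)
    have hpow : (1 + t * l) ^ (n / 2) ≤ (K ^ 3) ^ (n / 2) := by
      calc (1 + t * l) ^ (n / 2)
          = ∏ r : Fin (n / 2), (1 + t * l) := by simp
        _ ≤ ∏ r : Fin (n / 2), (1 + t * lam (Fin.castLE (Nat.div_le_self n 2) r)) := by
            refine Finset.prod_le_prod (fun _ _ => by positivity) fun r _ => ?_
            gcongr
            exact hl _ r.2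
        _ = ∏ i ∈ Finset.univ.map (Fin.castLEEmb (Nat.div_le_self n 2)), (1 + t * lam i) := by
            simp
        _ ≤ ∏ i, (1 + t * lam i) := by
            refine Finset.prod_le_prod_of_subset_of_one_le (Finset.subset_univ _)
              (fun i _ => ?_) fun i _ _ => ?_
            all_goals have := mul_nonneg ht0 (hlam i); linarith
        _ ≤ K ^ n := hle
        _ ≤ K ^ (3 * (n / 2)) := pow_le_pow_right₀ hK1 (by omega)
        _ = (K ^ 3) ^ (n / 2) := pow_mul _ _ _
    have h1 := le_of_pow_le_pow_left₀ (by omega) (by positivity) hpow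
    have h2 : t * l ≤ K ^ 3 := by linarith
    rw [ht, div_mul_eq_mul_div, div_le_iff₀ (by positivity)] at h2
    linarith
  have hcont : ContinuousWithinAt (fun D => K ^ 3 * m * D ^ 2) (Set.Ioi (herdisc A)) (herdisc A) :=
    by fun_prop
  exact ge_of_tendsto hcont (eventually_nhdsWithin_of_forall key)

lemma sum_sq_entries_eq {m n : ℕ} {H : Matrix (Fin n) (Fin n) ℝ} (hH : H * Hᵀ = 1)
    (B : Matrix (Fin m) (Fin n) ℝ) :
    ∑ i, ∑ j, B i j ^ 2 = ∑ l, ∑ i, (B.mulVec (H l) i) ^ 2 := by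
  rw [Finset.sum_comm (γ := Fin n)]
  refine Finset.sum_congr rfl fun i _ => ?_
  rw [← sum_sq_mulVec_of_orthogonal hH (B i)]
  simp [Matrix.mulVec, dotProduct_comm]

/-- there is a universal `c > 0` such that for every `A ∈ ℝ^{m×n}` with
`m ≥ n ≥ 2`, if `V ∈ ℝ^{⌊n/2⌋×n}` has as rows the orthonormal eigenvectors of `AᵀA`
corresponding to the `⌊n/2⌋` largest eigenvalues, then at most `m/2` rows of
`A(I - VᵀV)` have Euclidean norm exceeding `c·herdisc(A)`. -/
theorem stmt11 : ∃ c : ℝ, c > 0 ∧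
    ∀ (m n : ℕ) (A : Matrix (Fin m) (Fin n) ℝ), 2 ≤ n → n ≤ m →
      ∀ (lam : Fin n → ℝ) (η : Fin n → Fin n → ℝ),
        (∀ i j : Fin n, i ≤ j → lam j ≤ lam i) →
        (∀ i, 0 ≤ lam i) →
        (∀ i j : Fin n, (∑ t, η i t * η j t) = if i = j then 1 else 0) →
        (∀ i, (Aᵀ * A).mulVec (η i) = lam i • η i) →
        ∀ V : Matrix (Fin (n / 2)) (Fin n) ℝ,
          (∀ r : Fin (n / 2), V r = η (Fin.castLE (Nat.div_le_self n 2) r)) →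
          2 * (Finset.univ.filter fun i : Fin m =>
              c * herdisc A < Real.sqrt
                (∑ jj, ((A * ((1 : Matrix (Fin n) (Fin n) ℝ) - Vᵀ * V)) i jj) ^ 2)).card
            ≤ m := by
  set K : ℝ := 8 * Real.pi * Real.exp 1 ^ 2 with hK
  have hK0 : 0 < K := by positivity
  refine ⟨√(2 * K ^ 3), by positivity, ?_⟩
  intro m n A hn hnm lam η hmono hlam horth heig V hV
  have : NeZero m := ⟨by omega⟩
  set B := A * ((1 : Matrix (Fin n) (Fin n) ℝ) - Vᵀ * V) with hB
  have hH : (Matrix.of η) * (Matrix.of η)ᵀ = 1 := by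
    ext i j
    simpa [Matrix.mul_apply, Matrix.one_apply] using horth i j
  have hherdisc : 0 ≤ herdisc A := by
    obtain ⟨x, -, h⟩ := exists_signing_abs_le_herdisc A ∅
    exact (abs_nonneg _).trans (h 0)
  set l : ℝ := lam ⟨n / 2 - 1, by omega⟩ with hl
  have hl0 : 0 ≤ l := hlam _
  have hbound : n * l ≤ K ^ 3 * m * herdisc A ^ 2 :=
    mul_eigenvalue_le hn hH hlam heig hherdisc hl0 fun i hi =>
      hmono _ _ (Fin.le_def.2 (by simp only; omega))
  have hcol : ∀ k, ∑ i, (B.mulVec (η k) i) ^ 2 ≤ l := by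
    intro k
    have hVk : ∀ r, V.mulVec (η k) r =
        if Fin.castLE (Nat.div_le_self n 2) r = k then 1 else 0 := fun r => by
      rw [← horth, Matrix.mulVec, hV]
      rfl
    by_cases hk : (k : ℕ) < n / 2
    · have hproj : Vᵀ.mulVec (V.mulVec (η k)) = η k := by
        ext j
        rw [Matrix.mulVec, dotProduct, Finset.sum_eq_single ⟨k, hk⟩]
        · simp [hVk, hV]
        · intro r _ hr
          have : Fin.castLE (Nat.div_le_self n 2) r ≠ k := fun h => hr (by ext; simp [← h])
          simp [hVk, this]
        · simp
      have : B.mulVec (η k) = 0 := by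
        rw [hB, ← Matrix.mulVec_mulVec, Matrix.sub_mulVec, Matrix.one_mulVec,
          ← Matrix.mulVec_mulVec, hproj, sub_self, Matrix.mulVec_zero]
      simpa [this] using hl0
    · have hproj : V.mulVec (η k) = 0 := by
        ext r
        have : Fin.castLE (Nat.div_le_self n 2) r ≠ k := by
          rintro rfl
          exact hk (by simp)
        simp [hVk, this]
      have : B.mulVec (η k) = A.mulVec (η k) := by
        rw [hB, ← Matrix.mulVec_mulVec, Matrix.sub_mulVec, Matrix.one_mulVec,
          ← Matrix.mulVec_mulVec, hproj, Matrix.mulVec_zero, sub_zero]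
      have hnorm : η k ⬝ᵥ η k = 1 := by simpa [dotProduct] using horth k k
      rw [this, sum_sq_mulVec_eq, heig, dotProduct_smul, hnorm, smul_eq_mul, mul_one]
      exact hmono _ _ (Fin.le_def.2 (by simp only; omega))
  have hfrob : ∑ i, ∑ j, B i j ^ 2 ≤ K ^ 3 * m * herdisc A ^ 2 := by
    rw [sum_sq_entries_eq hH]
    refine (Finset.sum_le_sum fun k _ => hcol k).trans ?_
    simpa using hbound
  set T := Finset.univ.filter fun i : Fin m => √(2 * K ^ 3) * herdisc A < √(∑ j, B i j ^ 2) with hT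
  have hrow : ∀ i ∈ T, 2 * K ^ 3 * herdisc A ^ 2 < ∑ j, B i j ^ 2 := by
    intro i hi
    have h := (Real.lt_sqrt (by positivity)).1 (Finset.mem_filter.1 hi).2
    rwa [mul_pow, Real.sq_sqrt (by positivity)] at h
  have hmarkov : T.card * (2 * K ^ 3 * herdisc A ^ 2) ≤ ∑ i ∈ T, ∑ j, B i j ^ 2 := by
    rw [← nsmul_eq_mul]
    exact Finset.card_nsmul_le_sum _ _ _ fun i hi => (hrow i hi).le
  have hsub : ∑ i ∈ T, ∑ j, B i j ^ 2 ≤ ∑ i, ∑ j, B i j ^ 2 :=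
    Finset.sum_le_sum_of_subset_of_nonneg (Finset.subset_univ _) fun _ _ _ =>
      Finset.sum_nonneg fun _ _ => sq_nonneg _
  rcases hherdisc.eq_or_lt with h0 | hpos
  · have hempty : T = ∅ := by
      refine Finset.eq_empty_of_forall_notMem fun i hi => ?_
      have h1 := hrow i hi
      have h2 := Finset.single_le_sum (f := fun i => ∑ j, B i j ^ 2)
        (fun _ _ => Finset.sum_nonneg fun _ _ => sq_nonneg _) (Finset.mem_univ i)
      rw [← h0] at h1 hfrob
      simp only [ne_eq, OfNat.ofNat_ne_zero, not_false_eq_true, zero_pow, mul_zero] at h1 hfrob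
      linarith
    simp [hempty]
  · have h1 : (2 * T.card : ℝ) * (K ^ 3 * herdisc A ^ 2) ≤ m * (K ^ 3 * herdisc A ^ 2) := by
      linarith
    exact_mod_cast le_of_mul_le_mul_right h1 (by positivity)
end
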